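/- arXiv:2301.11748 — 2 statements merged into one kernel-verified Lean document; each statement's English description precedes it below -/
import Mathlib

section
/- Let M, N be von Neumann algebras and τ_N a faithful normal semi-finite trace on N. Consider a sequence of *-homomorphisms θ_n: M → N and a *-isomorphism θ: M → N such that τ_N∘θ = τ_N∘θ_n for all n. Let X be a subset of the unit ball of M that is dense in the strong operator topology and contains a sequence of projections (p_k) converging strongly to 1_M with τ_N(θ(p_k)) < ∞. If θ_n(x) → θ(x) strongly as n → ∞ for every x ∈ X, then θ_n → θ in the point-strong topology. -/
/-!
Common framework: concrete von Neumann algebras on complex Hilbert spaces,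
normal states and functionals, group actions, cocycle conjugacy, tensor product
realizations, Ocneanu ultrapower sequence algebras, traces, amenability, etc.
-/

open scoped InnerProductSpace ENNReal
open Filter Topology

set_option linter.unusedSectionVars false

noncomputable section

namespace SSAW

/-- A bundled complex Hilbert space. -/
structure HilbertSpaceC : Type 1 where
  carrier : Type
  [nacg : NormedAddCommGroup carrier]
  [ips : InnerProductSpace ℂ carrier]
  [cs : CompleteSpace carrier]

attribute [instance] HilbertSpaceC.nacg HilbertSpaceC.ips HilbertSpaceC.cs

variable {H : Type} [NormedAddCommGroup H] [InnerProductSpace ℂ H] [CompleteSpace H]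
variable {K : Type} [NormedAddCommGroup K] [InnerProductSpace ℂ K] [CompleteSpace K]
variable {L : Type} [NormedAddCommGroup L] [InnerProductSpace ℂ L] [CompleteSpace L]

/-- A positive normal functional on `B(H)`, presented by an `ℓ²`-family of vectors. -/
def IsPositiveNormalFunctional (φ : (H →L[ℂ] H) → ℂ) : Prop :=
  ∃ ξ : ℕ → H, Summable (fun i => ‖ξ i‖ ^ 2) ∧
    ∀ a : H →L[ℂ] H, φ a = ∑' i, ⟪ξ i, a (ξ i)⟫_ℂ

/-- A normal (σ-weakly continuous) functional on `B(H)`. -/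
def IsNormalFunctional (φ : (H →L[ℂ] H) → ℂ) : Prop :=
  ∃ ξ η : ℕ → H, Summable (fun i => ‖ξ i‖ ^ 2) ∧ Summable (fun i => ‖η i‖ ^ 2) ∧
    ∀ a : H →L[ℂ] H, φ a = ∑' i, ⟪ξ i, a (η i)⟫_ℂ

/-- The norm of a functional restricted to (the unit ball of) a subset of `B(H)`. -/
def normOn (S : Set (H →L[ℂ] H)) (φ : (H →L[ℂ] H) → ℂ) : ℝ :=
  sSup ((fun x => ‖φ x‖) '' {x | x ∈ S ∧ ‖x‖ ≤ 1})

/-- A normal state on the von Neumann algebra `M` (recorded as a functional on all of `B(H)`). -/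
def IsNormalState (_M : VonNeumannAlgebra H) (φ : (H →L[ℂ] H) → ℂ) : Prop :=
  IsPositiveNormalFunctional φ ∧ φ 1 = 1

/-- Faithfulness of a functional on `M`. -/
def FaithfulOn (M : VonNeumannAlgebra H) (φ : (H →L[ℂ] H) → ℂ) : Prop :=
  ∀ x ∈ M, φ (star x * x) = 0 → x = 0

/-- Traciality of a functional on `M`. -/
def IsTracialOn (M : VonNeumannAlgebra H) (φ : (H →L[ℂ] H) → ℂ) : Prop :=
  ∀ x ∈ M, ∀ y ∈ M, φ (x * y) = φ (y * x)

/-- `‖x‖_φ = φ(x*x)^{1/2}`. -/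
def stateNorm (φ : (H →L[ℂ] H) → ℂ) (x : H →L[ℂ] H) : ℝ :=
  Real.sqrt (φ (star x * x)).re

/-- `‖x‖_φ^♯ = φ(x*x + xx*)^{1/2}`. -/
def sharpNorm (φ : (H →L[ℂ] H) → ℂ) (x : H →L[ℂ] H) : ℝ :=
  Real.sqrt (φ (star x * x + x * star x)).re

def IsProjectionOp (p : H →L[ℂ] H) : Prop := p * p = p ∧ star p = p

def IsUnitaryIn (M : VonNeumannAlgebra H) (u : H →L[ℂ] H) : Prop :=
  u ∈ M ∧ star u * u = 1 ∧ u * star u = 1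

/-- The center `Z(M)` of a von Neumann algebra, as a set of operators. -/
def VNCenter (M : VonNeumannAlgebra H) : Set (H →L[ℂ] H) :=
  {x | x ∈ M ∧ ∀ y ∈ M, x * y = y * x}

/-- `M` is a factor. -/
def IsFactor (M : VonNeumannAlgebra H) : Prop :=
  ∀ x ∈ VNCenter M, ∃ c : ℂ, x = c • (1 : H →L[ℂ] H)

/-- `M` is σ-finite: it admits a faithful normal state. -/
def SigmaFinite (M : VonNeumannAlgebra H) : Prop :=
  ∃ φ : (H →L[ℂ] H) → ℂ, IsNormalState M φ ∧ FaithfulOn M φ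

/-- `M` has separable predual. -/
def SeparablePredual (M : VonNeumannAlgebra H) : Prop :=
  ∃ D : Set ((H →L[ℂ] H) → ℂ), D.Countable ∧ (∀ φ ∈ D, IsNormalFunctional φ) ∧
    ∀ φ : (H →L[ℂ] H) → ℂ, IsNormalFunctional φ → ∀ ε : ℝ, 0 < ε →
      ∃ ψ ∈ D, normOn (M : Set (H →L[ℂ] H)) (fun x => φ x - ψ x) ≤ ε

/-- A *-homomorphism between concrete von Neumann algebras, recorded as a map on all
bounded operators together with the algebraic properties on the members of `M`. -/
structure VNHom (M : VonNeumannAlgebra H) (N : VonNeumannAlgebra K) where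
  toFun : (H →L[ℂ] H) → (K →L[ℂ] K)
  mem' : ∀ x ∈ M, toFun x ∈ N
  map_add' : ∀ x ∈ M, ∀ y ∈ M, toFun (x + y) = toFun x + toFun y
  map_smul' : ∀ (c : ℂ), ∀ x ∈ M, toFun (c • x) = c • toFun x
  map_mul' : ∀ x ∈ M, ∀ y ∈ M, toFun (x * y) = toFun x * toFun y
  map_star' : ∀ x ∈ M, toFun (star x) = star (toFun x)

/-- A unital *-homomorphism. -/
def VNHom.Unital {M : VonNeumannAlgebra H} {N : VonNeumannAlgebra K} (f : VNHom M N) : Prop :=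
  f.toFun 1 = 1

/-- Normality (σ-weak continuity) of a *-homomorphism. -/
def VNHom.Normal {M : VonNeumannAlgebra H} {N : VonNeumannAlgebra K} (f : VNHom M N) : Prop :=
  ∀ ψ : (K →L[ℂ] K) → ℂ, IsNormalFunctional ψ →
    ∃ ψ' : (H →L[ℂ] H) → ℂ, IsNormalFunctional ψ' ∧ ∀ x ∈ M, ψ (f.toFun x) = ψ' x

/-- `M` and `N` are isomorphic von Neumann algebras. -/
def IsVNIso (M : VonNeumannAlgebra H) (N : VonNeumannAlgebra K) : Prop :=
  ∃ f : VNHom M N, f.Unital ∧ f.Normal ∧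
    Set.BijOn f.toFun (M : Set (H →L[ℂ] H)) (N : Set (K →L[ℂ] K))

/-- A (point-predual-norm continuous) action of a topological group `G` on the von Neumann
algebra `M` by *-automorphisms. -/
structure VNAction (G : Type) [Group G] [TopologicalSpace G]
    {H : Type} [NormedAddCommGroup H] [InnerProductSpace ℂ H] [CompleteSpace H]
    (M : VonNeumannAlgebra H) where
  toFun : G → (H →L[ℂ] H) → (H →L[ℂ] H)
  mem' : ∀ g, ∀ x ∈ M, toFun g x ∈ M
  map_add' : ∀ g, ∀ x ∈ M, ∀ y ∈ M, toFun g (x + y) = toFun g x + toFun g y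
  map_smul' : ∀ g (c : ℂ), ∀ x ∈ M, toFun g (c • x) = c • toFun g x
  map_mul' : ∀ g, ∀ x ∈ M, ∀ y ∈ M, toFun g (x * y) = toFun g x * toFun g y
  map_star' : ∀ g, ∀ x ∈ M, toFun g (star x) = star (toFun g x)
  map_one' : ∀ g, toFun g 1 = 1
  id_eq' : ∀ x ∈ M, toFun 1 x = x
  comp_eq' : ∀ g h, ∀ x ∈ M, toFun (g * h) x = toFun g (toFun h x)
  continuous' : ∀ φ : (H →L[ℂ] H) → ℂ, IsNormalFunctional φ → ∀ ε : ℝ, 0 < ε →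
    ∃ U ∈ 𝓝 (1 : G), ∀ g ∈ U,
      normOn (M : Set (H →L[ℂ] H)) (fun x => φ (toFun g x) - φ x) ≤ ε

lemma normOn_zero_le {S : Set (H →L[ℂ] H)} {ψ : (H →L[ℂ] H) → ℂ}
    (hψ : ∀ x ∈ S, ‖x‖ ≤ 1 → ψ x = 0) {ε : ℝ} (hε : 0 ≤ ε) : normOn S ψ ≤ ε := by
  apply Real.sSup_le _ hε
  rintro y ⟨x, ⟨hxS, hx1⟩, rfl⟩
  simpa [hψ x hxS hx1] using hε

/-- The trivial action of `G` on `M`. -/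
def trivialVNAction (G : Type) [Group G] [TopologicalSpace G]
    (M : VonNeumannAlgebra H) : VNAction G M where
  toFun _ x := x
  mem' _ _ hx := hx
  map_add' _ _ _ _ _ := rfl
  map_smul' _ _ _ _ := rfl
  map_mul' _ _ _ _ _ := rfl
  map_star' _ _ _ := rfl
  map_one' _ := rfl
  id_eq' _ _ := rfl
  comp_eq' _ _ _ _ := rfl
  continuous' φ _ ε hε :=
    ⟨Set.univ, Filter.univ_mem, fun _ _ =>
      normOn_zero_le (fun x _ _ => by simp) hε.le⟩

/-- Pulling back an action along a group quotient map (for discrete acting groups). -/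
def VNAction.pullback {G G₀ : Type} [Group G] [TopologicalSpace G] [DiscreteTopology G]
    [Group G₀] [TopologicalSpace G₀] {M : VonNeumannAlgebra H}
    (δ : VNAction G₀ M) (π : G →* G₀) : VNAction G M where
  toFun g := δ.toFun (π g)
  mem' g := δ.mem' (π g)
  map_add' g := δ.map_add' (π g)
  map_smul' g := δ.map_smul' (π g)
  map_mul' g := δ.map_mul' (π g)
  map_star' g := δ.map_star' (π g)
  map_one' g := δ.map_one' (π g)
  id_eq' x hx := by
    show δ.toFun (π 1) x = x
    rw [map_one]; exact δ.id_eq' x hx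
  comp_eq' g h x hx := by
    show δ.toFun (π (g * h)) x = δ.toFun (π g) (δ.toFun (π h) x)
    rw [map_mul]; exact δ.comp_eq' (π g) (π h) x hx
  continuous' φ _ ε hε := by
    refine ⟨{1}, IsOpen.mem_nhds (isOpen_discrete _) rfl, ?_⟩
    intro g hg
    have hg1 : g = 1 := hg
    subst hg1
    apply normOn_zero_le _ hε.le
    intro x hx _
    show φ (δ.toFun (π 1) x) - φ x = 0
    rw [map_one, δ.id_eq' x hx, sub_self]

/-- A cocycle conjugacy `(θ, u) : (M, α) → (N, β)`. -/
structure CocycleConjugacy {G : Type} [Group G] [TopologicalSpace G]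
    {M : VonNeumannAlgebra H} {N : VonNeumannAlgebra K}
    (α : VNAction G M) (β : VNAction G N) where
  toHom : VNHom M N
  unital : toHom.Unital
  normal : toHom.Normal
  bij : Set.BijOn toHom.toFun (M : Set (H →L[ℂ] H)) (N : Set (K →L[ℂ] K))
  u : G → (K →L[ℂ] K)
  u_unitary : ∀ g, IsUnitaryIn N (u g)
  u_cont : ∀ ξ : K, Continuous fun g => (u g) ξ
  intertwine : ∀ g, ∀ x ∈ M,
    toHom.toFun (α.toFun g x) = u g * β.toFun g (toHom.toFun x) * star (u g)
  cocycle : ∀ g h, u (g * h) = u g * β.toFun g (u h)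

/-- Two actions are cocycle conjugate. -/
def CocycleConjugate {G : Type} [Group G] [TopologicalSpace G]
    {M : VonNeumannAlgebra H} {N : VonNeumannAlgebra K}
    (α : VNAction G M) (β : VNAction G N) : Prop :=
  Nonempty (CocycleConjugacy α β)

/-- A realization of the von Neumann tensor product `M ⊗̄ N` on a Hilbert space. -/
structure TensorProductOf (M : VonNeumannAlgebra H) (N : VonNeumannAlgebra K)
    (P : VonNeumannAlgebra L) where
  e₁ : VNHom M P
  e₂ : VNHom N P
  unital₁ : e₁.Unital
  unital₂ : e₂.Unital
  normal₁ : e₁.Normal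
  normal₂ : e₂.Normal
  inj₁ : Set.InjOn e₁.toFun (M : Set (H →L[ℂ] H))
  inj₂ : Set.InjOn e₂.toFun (N : Set (K →L[ℂ] K))
  commutes : ∀ x ∈ M, ∀ y ∈ N, e₁.toFun x * e₂.toFun y = e₂.toFun y * e₁.toFun x
  generates : ∀ Q : VonNeumannAlgebra L, (∀ x ∈ M, e₁.toFun x ∈ Q) →
    (∀ y ∈ N, e₂.toFun y ∈ Q) → ∀ z ∈ P, z ∈ Q
  productStates : ∀ (φ : (H →L[ℂ] H) → ℂ) (ψ : (K →L[ℂ] K) → ℂ),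
    IsNormalState M φ → IsNormalState N ψ →
    ∃ θ : (L →L[ℂ] L) → ℂ, IsNormalState P θ ∧
      ∀ x ∈ M, ∀ y ∈ N, θ (e₁.toFun x * e₂.toFun y) = φ x * ψ y

/-- The action `γ` on `P` realizes the tensor product action `α ⊗ δ` through the
tensor product realization `T`. -/
def TensorProductOf.IsEquivariant {G : Type} [Group G] [TopologicalSpace G]
    {M : VonNeumannAlgebra H} {N : VonNeumannAlgebra K} {P : VonNeumannAlgebra L}
    (T : TensorProductOf M N P) (α : VNAction G M) (δ : VNAction G N)
    (γ : VNAction G P) : Prop :=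
  (∀ g, ∀ x ∈ M, γ.toFun g (T.e₁.toFun x) = T.e₁.toFun (α.toFun g x)) ∧
  (∀ g, ∀ y ∈ N, γ.toFun g (T.e₂.toFun y) = T.e₂.toFun (δ.toFun g y))

/-- `α : G ↷ M` is cocycle conjugate to `α ⊗ δ` (through some realization of the
tensor product action). -/
def AbsorbsTensor {G : Type} [Group G] [TopologicalSpace G]
    {M : VonNeumannAlgebra H} {R : VonNeumannAlgebra K}
    (α : VNAction G M) (δ : VNAction G R) : Prop :=
  ∃ (L : HilbertSpaceC) (P : VonNeumannAlgebra L.carrier) (γ : VNAction G P)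
    (T : TensorProductOf M R P), T.IsEquivariant α δ γ ∧ CocycleConjugate α γ

/-- Approximate unitary equivalence (with respect to the `‖·‖_τ`-seminorm of a state `τ` on
the target) of two cocycle morphisms, given by raw data `(f₁, u₁)`, `(f₂, u₂)`, defined on a
source set `S`, with target action `β : G ↷ P`. -/
def ApproxUEqRaw {G : Type} [Group G] [TopologicalSpace G] {K₀ : Type}
    [NormedAddCommGroup K₀] [InnerProductSpace ℂ K₀] [CompleteSpace K₀]
    (P : VonNeumannAlgebra L) (β : VNAction G P) (τ : (L →L[ℂ] L) → ℂ)
    (S : Set (K₀ →L[ℂ] K₀)) (f₁ f₂ : (K₀ →L[ℂ] K₀) → (L →L[ℂ] L))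
    (u₁ u₂ : G → (L →L[ℂ] L)) : Prop :=
  ∃ w : ℕ → (L →L[ℂ] L), (∀ n, IsUnitaryIn P (w n)) ∧
    (∀ x ∈ S, Tendsto (fun n => stateNorm τ (w n * f₁ x * star (w n) - f₂ x)) atTop (𝓝 0)) ∧
    ∀ Kc : Set G, IsCompact Kc →
      Tendsto (fun n => ⨆ g ∈ Kc,
        stateNorm τ (w n * u₁ g * β.toFun g (star (w n)) - u₂ g)) atTop (𝓝 0)

/-- `α` strongly absorbs `δ`: the equivariant embedding `id_M ⊗ 1` into (a realization of)
`(M ⊗̄ R, α ⊗ δ)` is approximately unitarily equivalent to a cocycle conjugacy. -/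
def StrongAbsorption {G : Type} [Group G] [TopologicalSpace G]
    {M : VonNeumannAlgebra H} {R : VonNeumannAlgebra K}
    (α : VNAction G M) (δ : VNAction G R) : Prop :=
  ∃ (L : HilbertSpaceC) (P : VonNeumannAlgebra L.carrier) (γ : VNAction G P)
    (T : TensorProductOf M R P), T.IsEquivariant α δ γ ∧
    ∃ (cc : CocycleConjugacy α γ) (τP : (L.carrier →L[ℂ] L.carrier) → ℂ),
      IsNormalState P τP ∧ IsTracialOn P τP ∧ FaithfulOn P τP ∧
      ApproxUEqRaw P γ τP (M : Set (H →L[ℂ] H)) T.e₁.toFun cc.toHom.toFun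
        (fun _ => 1) cc.u

/-- A strongly self-absorbing action on (a copy of) the hyperfinite II₁ factor. -/
def StronglySelfAbsorbing {G : Type} [Group G] [TopologicalSpace G]
    {R : VonNeumannAlgebra K} (δ : VNAction G R) : Prop :=
  StrongAbsorption δ δ

/-- `δ` has approximately inner half-flip: the two equivariant embeddings
`id_R ⊗ 1` and `1 ⊗ id_R` into `(R ⊗̄ R, δ ⊗ δ)` are approximately unitarily equivalent. -/
def ApproxInnerHalfFlip {G : Type} [Group G] [TopologicalSpace G]
    {R : VonNeumannAlgebra K} (δ : VNAction G R) : Prop :=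
  ∃ (L : HilbertSpaceC) (P : VonNeumannAlgebra L.carrier) (γ : VNAction G P)
    (T : TensorProductOf R R P), T.IsEquivariant δ δ γ ∧
    ∃ τP : (L.carrier →L[ℂ] L.carrier) → ℂ,
      IsNormalState P τP ∧ IsTracialOn P τP ∧ FaithfulOn P τP ∧
      ApproxUEqRaw P γ τP (R : Set (K →L[ℂ] K)) T.e₁.toFun T.e₂.toFun
        (fun _ => 1) (fun _ => 1)

/-- Finite-dimensionality of a subset of `B(H)` (contained in a f.d. subspace). -/
def FinDimIn (S : Set (H →L[ℂ] H)) : Prop :=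
  ∃ t : Finset (H →L[ℂ] H),
    S ⊆ (Submodule.span ℂ (t : Set (H →L[ℂ] H)) : Submodule ℂ (H →L[ℂ] H))

/-- `R` is (a copy of) the hyperfinite II₁ factor: an infinite-dimensional hyperfinite
factor with a faithful normal tracial state. -/
def IsHyperfiniteIIOneFactor (R : VonNeumannAlgebra H) : Prop :=
  IsFactor R ∧
  (∃ τ : (H →L[ℂ] H) → ℂ, IsNormalState R τ ∧ IsTracialOn R τ ∧ FaithfulOn R τ) ∧
  ¬ FinDimIn (R : Set (H →L[ℂ] H)) ∧
  ∃ A : ℕ → Set (H →L[ℂ] H),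
    (∀ n, A n ⊆ (R : Set (H →L[ℂ] H)) ∧ (1 : H →L[ℂ] H) ∈ A n ∧
      (∀ x ∈ A n, ∀ y ∈ A n, x + y ∈ A n ∧ x * y ∈ A n) ∧
      (∀ (c : ℂ), ∀ x ∈ A n, c • x ∈ A n) ∧ (∀ x ∈ A n, star x ∈ A n) ∧
      FinDimIn (A n)) ∧
    (∀ n, A n ⊆ A (n + 1)) ∧
    (∀ x ∈ R, ∀ ε : ℝ, 0 < ε → ∀ s : Finset H,
      ∃ n, ∃ y ∈ A n, ∀ ξ ∈ s, ‖(x - y) ξ‖ < ε)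

/-- `M` is McDuff (relative to the given copy `R` of the hyperfinite II₁ factor):
`M ≅ M ⊗̄ R`. -/
def IsMcDuff (M : VonNeumannAlgebra H) (R : VonNeumannAlgebra K) : Prop :=
  ∃ (L : HilbertSpaceC) (P : VonNeumannAlgebra L.carrier)
    (_T : TensorProductOf M R P), IsVNIso M P

/-- A faithful normal semi-finite trace on `M` (as an `ℝ≥0∞`-valued weight,
determined by its values on positive elements). -/
structure FNSTrace (M : VonNeumannAlgebra H) where
  toFun : (H →L[ℂ] H) → ℝ≥0∞
  map_add' : ∀ x ∈ M, ∀ y ∈ M, x.IsPositive → y.IsPositive →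
    toFun (x + y) = toFun x + toFun y
  map_smul' : ∀ (c : ℝ), 0 ≤ c → ∀ x ∈ M, x.IsPositive →
    toFun ((c : ℂ) • x) = ENNReal.ofReal c * toFun x
  tracial' : ∀ x ∈ M, toFun (star x * x) = toFun (x * star x)
  normal' : ∀ (f : ℕ → (H →L[ℂ] H)), ∀ x ∈ M, (∀ n, f n ∈ M ∧ (f n).IsPositive) →
    (∀ n, (f (n + 1) - f n).IsPositive) →
    (∀ ξ : H, Tendsto (fun n => f n ξ) atTop (𝓝 (x ξ))) →
    toFun x = ⨆ n, toFun (f n)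
  faithful' : ∀ x ∈ M, x.IsPositive → toFun x = 0 → x = 0
  semifinite' : ∀ x ∈ M, x.IsPositive → x ≠ 0 →
    ∃ y ∈ (M : Set (H →L[ℂ] H)), y.IsPositive ∧ y ≠ 0 ∧ (x - y).IsPositive ∧ toFun y < ⊤

/-- `M` is semi-finite. -/
def IsSemifinite (M : VonNeumannAlgebra H) : Prop := Nonempty (FNSTrace M)

/-- `M` is finite (with separable predual): it admits a faithful normal tracial state. -/
def IsFiniteVN (M : VonNeumannAlgebra H) : Prop :=
  ∃ τ : (H →L[ℂ] H) → ℂ, IsNormalState M τ ∧ IsTracialOn M τ ∧ FaithfulOn M τ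

/-! ### Sequence algebras for the Ocneanu ultrapower -/

/-- A bounded sequence with entries in `M`. -/
def InSeqAlg (M : VonNeumannAlgebra H) (x : ℕ → (H →L[ℂ] H)) : Prop :=
  (∀ n, x n ∈ M) ∧ ∃ C : ℝ, ∀ n, ‖x n‖ ≤ C

/-- `(x_n) ∈ I_ω(M)`: a bounded sequence converging to `0` *-strongly along `ω`. -/
def IomegaSeq (ω : Ultrafilter ℕ) (M : VonNeumannAlgebra H) (x : ℕ → (H →L[ℂ] H)) : Prop :=
  InSeqAlg M x ∧ ∃ φ : (H →L[ℂ] H) → ℂ, IsNormalState M φ ∧ FaithfulOn M φ ∧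
    Tendsto (fun n => sharpNorm φ (x n)) (ω : Filter ℕ) (𝓝 0)

/-- `(x_n) ∈ N_ω(M)`: the multiplier set of `I_ω(M)`. -/
def NomegaSeq (ω : Ultrafilter ℕ) (M : VonNeumannAlgebra H) (x : ℕ → (H →L[ℂ] H)) : Prop :=
  InSeqAlg M x ∧ ∀ y : ℕ → (H →L[ℂ] H), IomegaSeq ω M y →
    IomegaSeq ω M (fun n => x n * y n) ∧ IomegaSeq ω M (fun n => y n * x n)

/-- `(x_n) ∈ C_ω(M)`: `lim_{n→ω} ‖[x_n, φ]‖ = 0` for every normal functional `φ`. -/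
def ComegaSeq (ω : Ultrafilter ℕ) (M : VonNeumannAlgebra H) (x : ℕ → (H →L[ℂ] H)) : Prop :=
  InSeqAlg M x ∧ ∀ φ : (H →L[ℂ] H) → ℂ, IsNormalFunctional φ →
    Tendsto (fun n => normOn (M : Set (H →L[ℂ] H)) (fun y => φ (y * x n) - φ (x n * y)))
      (ω : Filter ℕ) (𝓝 0)

/-- `(x_n) ∈ E_α^ω`: an `(α,ω)`-equicontinuous bounded sequence. -/
def EquicontSeq {G : Type} [Group G] [TopologicalSpace G] (ω : Ultrafilter ℕ)
    {M : VonNeumannAlgebra H} (α : VNAction G M) (x : ℕ → (H →L[ℂ] H)) : Prop :=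
  InSeqAlg M x ∧ ∃ φ : (H →L[ℂ] H) → ℂ, IsNormalState M φ ∧ FaithfulOn M φ ∧
    ∀ ε : ℝ, 0 < ε → ∃ W ∈ ω, ∃ U ∈ 𝓝 (1 : G), ∀ n ∈ W, ∀ g ∈ U,
      sharpNorm φ (α.toFun g (x n) - x n) < ε

/-- The ultralimit of a real sequence along `ω`. -/
def ultraRe (ω : Ultrafilter ℕ) (f : ℕ → ℝ) : ℝ := limUnder (ω : Filter ℕ) f

/-- The induced state `φ^ω` on the ultrapower, evaluated on a representing sequence. -/
def ultraState (ω : Ultrafilter ℕ) (φ : (H →L[ℂ] H) → ℂ) (x : ℕ → (H →L[ℂ] H)) : ℂ :=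
  limUnder (ω : Filter ℕ) fun n => φ (x n)

/-- `‖·‖_{φ^ω}` of (the class of) a representing sequence. -/
def ultraNorm (ω : Ultrafilter ℕ) (φ : (H →L[ℂ] H) → ℂ) (x : ℕ → (H →L[ℂ] H)) : ℝ :=
  Real.sqrt (ultraRe ω fun n => (φ (star (x n) * x n)).re)

/-- `‖·‖_{φ^ω}^♯` of (the class of) a representing sequence. -/
def ultraSharpNorm (ω : Ultrafilter ℕ) (φ : (H →L[ℂ] H) → ℂ) (x : ℕ → (H →L[ℂ] H)) : ℝ :=
  Real.sqrt (ultraRe ω fun n => (φ (star (x n) * x n + x n * star (x n))).re)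

/-- A unital equivariant *-homomorphism `(R, δ) → (M_{ω,α}, α_ω)`, recorded on
representing sequences (all identities hold modulo `I_ω(M)`). -/
structure UltraHom {G : Type} [Group G] [TopologicalSpace G] (ω : Ultrafilter ℕ)
    {K₀ : Type} [NormedAddCommGroup K₀] [InnerProductSpace ℂ K₀] [CompleteSpace K₀]
    {H₀ : Type} [NormedAddCommGroup H₀] [InnerProductSpace ℂ H₀] [CompleteSpace H₀]
    {R : VonNeumannAlgebra K₀} {M : VonNeumannAlgebra H₀}
    (δ : VNAction G R) (α : VNAction G M) where
  toFun : (K₀ →L[ℂ] K₀) → ℕ → (H₀ →L[ℂ] H₀)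
  mem' : ∀ x ∈ R, EquicontSeq ω α (toFun x) ∧ NomegaSeq ω M (toFun x) ∧
    ComegaSeq ω M (toFun x)
  map_add' : ∀ x ∈ R, ∀ y ∈ R,
    IomegaSeq ω M (fun n => toFun (x + y) n - (toFun x n + toFun y n))
  map_smul' : ∀ (c : ℂ), ∀ x ∈ R,
    IomegaSeq ω M (fun n => toFun (c • x) n - c • toFun x n)
  map_mul' : ∀ x ∈ R, ∀ y ∈ R,
    IomegaSeq ω M (fun n => toFun (x * y) n - toFun x n * toFun y n)
  map_star' : ∀ x ∈ R, IomegaSeq ω M (fun n => toFun (star x) n - star (toFun x n))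
  map_one' : IomegaSeq ω M (fun n => toFun 1 n - 1)
  equivariant' : ∀ g, ∀ x ∈ R,
    IomegaSeq ω M (fun n => α.toFun g (toFun x n) - toFun (δ.toFun g x) n)

/-- Amenability of an action of a discrete group, via a `G`-equivariant conditional
expectation `ℓ∞(G) ⊗̄ M → M` (here `ℓ∞(G) ⊗̄ M` is realized as bounded `M`-valued
functions on `G`). -/
def AmenableVNAction {G : Type} [Group G] [TopologicalSpace G]
    {M : VonNeumannAlgebra H} (α : VNAction G M) : Prop :=
  ∃ E : (G → (H →L[ℂ] H)) → (H →L[ℂ] H),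
    (∀ f : G → (H →L[ℂ] H), (∀ g, f g ∈ M) → (∃ C : ℝ, ∀ g, ‖f g‖ ≤ C) →
        E f ∈ M) ∧
    (∀ f₁ f₂ : G → (H →L[ℂ] H), (∀ g, f₁ g ∈ M) → (∃ C : ℝ, ∀ g, ‖f₁ g‖ ≤ C) →
        (∀ g, f₂ g ∈ M) → (∃ C : ℝ, ∀ g, ‖f₂ g‖ ≤ C) →
        E (fun g => f₁ g + f₂ g) = E f₁ + E f₂) ∧
    (∀ (c : ℂ) (f : G → (H →L[ℂ] H)), (∀ g, f g ∈ M) → (∃ C : ℝ, ∀ g, ‖f g‖ ≤ C) →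
        E (fun g => c • f g) = c • E f) ∧
    (∀ f : G → (H →L[ℂ] H), (∀ g, f g ∈ M) → (∃ C : ℝ, ∀ g, ‖f g‖ ≤ C) →
        (∀ g, (f g).IsPositive) → (E f).IsPositive) ∧
    (E (fun _ => 1) = 1) ∧
    (∀ f : G → (H →L[ℂ] H), (∀ g, f g ∈ M) → (∃ C : ℝ, ∀ g, ‖f g‖ ≤ C) →
        ∀ a ∈ M, ∀ b ∈ M, E (fun g => a * f g * b) = a * E f * b) ∧
    (∀ f : G → (H →L[ℂ] H), (∀ g, f g ∈ M) → (∃ C : ℝ, ∀ g, ‖f g‖ ≤ C) →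
        ∀ g₀ : G, E (fun h => α.toFun g₀ (f (g₀⁻¹ * h))) = α.toFun g₀ (E f))

/-- Følner characterization of amenability for a (countable) discrete group. -/
def FolnerAmenable (G : Type) [Group G] : Prop :=
  ∀ (S : Finset G) (ε : ℝ), 0 < ε → ∃ F : Finset G, F.Nonempty ∧
    ∀ g ∈ S,
      letI := Classical.decEq G
      (((F.image fun x => g * x) \ F).card + (F \ F.image fun x => g * x).card : ℝ)
        ≤ ε * F.card

/-- Outerness of an action. -/
def IsOuter {G : Type} [Group G] [TopologicalSpace G] {R : VonNeumannAlgebra H}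
    (δ : VNAction G R) : Prop :=
  ∀ g : G, g ≠ 1 → ¬ ∃ u : H →L[ℂ] H, IsUnitaryIn R u ∧
    ∀ x ∈ R, δ.toFun g x = u * x * star u

/-- The induced automorphism `α_{ω,g}` of the asymptotic centralizer `M_ω` is trivial. -/
def CentrallyTrivialSeq {G : Type} [Group G] [TopologicalSpace G] (ω : Ultrafilter ℕ)
    {M : VonNeumannAlgebra H} (α : VNAction G M) (g : G) : Prop :=
  ∀ x : ℕ → (H →L[ℂ] H), ComegaSeq ω M x →
    IomegaSeq ω M (fun n => α.toFun g (x n) - x n)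

/-- `α_g` is properly centrally non-trivial: for every non-zero central projection `p`,
the induced automorphism of `M_ω` is non-trivial on `p M_ω`. -/
def ProperlyCentrallyNontrivial {G : Type} [Group G] [TopologicalSpace G]
    (ω : Ultrafilter ℕ) {M : VonNeumannAlgebra H} (α : VNAction G M) (g : G) : Prop :=
  ∀ p : H →L[ℂ] H, p ∈ VNCenter M → IsProjectionOp p → p ≠ 0 →
    ∃ x : ℕ → (H →L[ℂ] H), ComegaSeq ω M x ∧
      ¬ IomegaSeq ω M (fun n => p * (α.toFun g (x n) - x n))

open scoped NNReal

/-! ### Order and strong limits in a von Neumann algebra -/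

lemma smul_mem_vonNeumann (M : VonNeumannAlgebra H) (c : ℂ) {x : H →L[ℂ] H} (hx : x ∈ M) :
    c • x ∈ M :=
  M.toStarSubalgebra.smul_mem hx c

lemma mem_of_commute {M : VonNeumannAlgebra H} {x : H →L[ℂ] H}
    (h : ∀ y ∈ M.commutant, Commute y x) : x ∈ M := by
  rw [← M.commutant_commutant, VonNeumannAlgebra.mem_commutant_iff]
  exact h

lemma commute_of_mem {M : VonNeumannAlgebra H} {x y : H →L[ℂ] H} (hx : x ∈ M)
    (hy : y ∈ M.commutant) : Commute y x :=
  (VonNeumannAlgebra.mem_commutant_iff.1 hy x hx).symm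

/-- A von Neumann algebra is closed under pointwise sequential limits. -/
lemma mem_of_tendsto_apply {M : VonNeumannAlgebra H} {f : ℕ → H →L[ℂ] H} {x : H →L[ℂ] H}
    (hf : ∀ n, f n ∈ M) (hx : ∀ ξ, Tendsto (fun n => f n ξ) atTop (𝓝 (x ξ))) : x ∈ M := by
  refine mem_of_commute fun y hy => ?_
  ext ξ
  refine tendsto_nhds_unique (((y.continuous.tendsto _).comp (hx ξ)).congr fun n => ?_) (hx (y ξ))
  exact congr($(commute_of_mem (hf n) hy) ξ)

open scoped ComplexOrder in
lemma le_of_tendsto_apply {f : ℕ → H →L[ℂ] H} {x c : H →L[ℂ] H}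
    (hx : ∀ ξ, Tendsto (fun n => f n ξ) atTop (𝓝 (x ξ))) (hf : ∀ n, f n ≤ c) : x ≤ c := by
  rw [ContinuousLinearMap.le_def, ContinuousLinearMap.isPositive_iff_complex]
  intro ξ
  have h1 : Tendsto (fun n => ⟪(c - f n) ξ, ξ⟫_ℂ) atTop (𝓝 ⟪(c - x) ξ, ξ⟫_ℂ) := by
    have : Tendsto (fun n => (c - f n) ξ) atTop (𝓝 ((c - x) ξ)) := by
      simpa using (tendsto_const_nhds (x := c ξ)).sub (hx ξ)
    exact this.inner tendsto_const_nhds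
  have h2 : ∀ n, 0 ≤ ⟪(c - f n) ξ, ξ⟫_ℂ := fun n =>
    ((ContinuousLinearMap.le_def _ _).1 (hf n)).inner_nonneg_left ξ
  have h3 : 0 ≤ ⟪(c - x) ξ, ξ⟫_ℂ := ge_of_tendsto' h1 h2
  rw [Complex.le_def] at h3
  exact ⟨Complex.ext rfl h3.2, h3.1⟩

lemma ge_of_tendsto_apply {f : ℕ → H →L[ℂ] H} {x c : H →L[ℂ] H}
    (hx : ∀ ξ, Tendsto (fun n => f n ξ) atTop (𝓝 (x ξ))) (hf : ∀ n, c ≤ f n) : c ≤ x := by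
  refine neg_le_neg_iff.1 (le_of_tendsto_apply (f := fun n => -f n) (fun ξ => ?_)
    fun n => neg_le_neg (hf n))
  simpa using (hx ξ).neg

lemma norm_apply_sq_le_of_nonneg {d : H →L[ℂ] H} (hd : 0 ≤ d) (hd1 : d ≤ 1) (ξ : H) :
    ‖d ξ‖ ^ 2 ≤ (⟪d ξ, ξ⟫_ℂ).re := by
  have h : d * d ≤ d := by
    have := CStarAlgebra.pow_antitone hd hd1 (show 1 ≤ 2 by norm_num)
    simpa [pow_two] using this
  have h2 := ((ContinuousLinearMap.le_def _ _).1 h).re_inner_nonneg_left ξ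
  have hsa : IsSelfAdjoint d := .of_nonneg hd
  have h3 : ⟪(d * d) ξ, ξ⟫_ℂ = ⟪d ξ, d ξ⟫_ℂ := by
    rw [ContinuousLinearMap.mul_def, ContinuousLinearMap.comp_apply,
      ← ContinuousLinearMap.adjoint_inner_right,
      ← ContinuousLinearMap.star_eq_adjoint, hsa.star_eq]
  rw [sub_apply, inner_sub_left, h3, inner_self_eq_norm_sq_to_K] at h2
  have : (((‖d ξ‖ : ℂ)) ^ 2).re = ‖d ξ‖ ^ 2 := by norm_cast
  simp at h2
  linarith

/-- Bounded increasing sequences in the unit interval converge strongly. -/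
lemma exists_tendsto_apply_of_monotone {f : ℕ → H →L[ℂ] H} (h0 : ∀ n, 0 ≤ f n)
    (h1 : ∀ n, f n ≤ 1) (hmono : Monotone f) :
    ∃ x : H →L[ℂ] H, ∀ ξ, Tendsto (fun n => f n ξ) atTop (𝓝 (x ξ)) := by
  have key : ∀ ξ, ∃ η, Tendsto (fun n => f n ξ) atTop (𝓝 η) := by
    intro ξ
    apply cauchySeq_tendsto_of_complete
    set q : ℕ → ℝ := fun n => (⟪f n ξ, ξ⟫_ℂ).re with hq
    have hdiff : ∀ n m, n ≤ m → ‖f m ξ - f n ξ‖ ^ 2 ≤ q m - q n := by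
      intro n m hnm
      have := norm_apply_sq_le_of_nonneg (sub_nonneg.2 (hmono hnm))
        ((sub_le_self _ (h0 n)).trans (h1 m)) ξ
      simpa [inner_sub_left, hq] using this
    have hqmono : Monotone q := fun n m hnm => by
      have := hdiff n m hnm
      nlinarith [sq_nonneg ‖f m ξ - f n ξ‖]
    have hqb : BddAbove (Set.range q) := by
      refine ⟨((‖ξ‖ : ℂ) ^ 2).re, ?_⟩
      rintro _ ⟨n, rfl⟩
      have := ((ContinuousLinearMap.le_def _ _).1 (h1 n)).re_inner_nonneg_left ξ
      simp [inner_sub_left] at this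
      simp only [hq]
      linarith
    have hc : CauchySeq q := (tendsto_atTop_ciSup hqmono hqb).cauchySeq
    rw [Metric.cauchySeq_iff'] at hc ⊢
    intro ε hε
    obtain ⟨N, hN⟩ := hc (ε ^ 2) (by positivity)
    refine ⟨N, fun n hn => ?_⟩
    have h2 := hN n hn
    rw [Real.dist_eq] at h2
    rw [dist_eq_norm]
    exact lt_of_pow_lt_pow_left₀ 2 hε.le
      ((hdiff N n hn).trans_lt ((le_abs_self _).trans_lt h2))
  choose g hg using key
  exact ⟨continuousLinearMapOfTendsto f (tendsto_pi_nhds.2 hg), hg⟩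

/-! ### The operator monotone contraction `b ↦ b (1 + b)⁻¹` -/

/-- The operator `b (1 + b)⁻¹` for a positive operator `b`. -/
def contraction (b : H →L[ℂ] H) : H →L[ℂ] H := cfcₙ (fun x : ℝ≥0 => 1 - (1 + x)⁻¹) b

lemma continuous_one_sub_one_add_inv : Continuous (fun x : ℝ≥0 => 1 - (1 + x)⁻¹) := by
  fun_prop (disch := intro _; positivity)

lemma contraction_mem {M : VonNeumannAlgebra H} {b : H →L[ℂ] H} (hb : b ∈ M) :
    contraction b ∈ M :=
  mem_of_commute fun _ hy => ((commute_of_mem hb hy).symm.cfcₙ_nnreal _).symm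

lemma contraction_nonneg (b : H →L[ℂ] H) : 0 ≤ contraction b := by
  unfold contraction
  simp

lemma contraction_le_one (b : H →L[ℂ] H) : contraction b ≤ 1 :=
  (CStarAlgebra.norm_le_one_iff_of_nonneg _ (contraction_nonneg b)).1
    (norm_cfcₙ_one_sub_one_add_inv_lt_one b).le

lemma contraction_mono {a b : H →L[ℂ] H} (ha : 0 ≤ a) (hab : a ≤ b) :
    contraction a ≤ contraction b :=
  CFC.monotoneOn_one_sub_one_add_inv ha (ha.trans hab) hab

lemma contraction_le_self {b : H →L[ℂ] H} (hb : 0 ≤ b) : contraction b ≤ b := by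
  conv_rhs => rw [← cfcₙ_id ℝ≥0 b]
  refine cfcₙ_mono (fun x _ => ?_) continuous_one_sub_one_add_inv.continuousOn
    continuous_id.continuousOn
  rw [id, tsub_le_iff_right]
  by_cases hx : x = 0
  · simp [hx]
  rw [← NNReal.coe_le_coe]
  push_cast
  have h0 : (0 : ℝ) ≤ x := x.2
  have : (1 : ℝ) ≤ x + (1 + (x : ℝ))⁻¹ := by
    field_simp
    nlinarith
  exact this

lemma le_contraction_add_contraction {a : H →L[ℂ] H} (ha : 0 ≤ a) (ha1 : a ≤ 1) :
    a ≤ contraction a + contraction a := by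
  have hn : ‖a‖ ≤ 1 := (CStarAlgebra.norm_le_one_iff_of_nonneg a ha).2 ha1
  unfold contraction
  rw [← cfcₙ_add _ _ _ continuous_one_sub_one_add_inv.continuousOn (by simp)
    continuous_one_sub_one_add_inv.continuousOn (by simp)]
  conv_lhs => rw [← cfcₙ_id ℝ≥0 a]
  refine cfcₙ_mono (fun x hx => ?_) continuous_id.continuousOn
    (continuous_one_sub_one_add_inv.add continuous_one_sub_one_add_inv).continuousOn
  have hx1 : x ≤ 1 := (CStarAlgebra.le_nnnorm_of_mem_quasispectrum hx).trans (by exact_mod_cast hn)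
  have h2 : (1 + x)⁻¹ ≤ 1 := inv_le_one_of_one_le₀ (by simp)
  rw [id, ← NNReal.coe_le_coe]
  push_cast [NNReal.coe_sub h2]
  have h0 : (0 : ℝ) ≤ x := x.2
  have h1 : (x : ℝ) ≤ 1 := by exact_mod_cast hx1
  have : (x : ℝ) ≤ 1 - (1 + x : ℝ)⁻¹ + (1 - (1 + x : ℝ)⁻¹) := by
    field_simp
    nlinarith
  exact this
/-! ### Sequentially normal finite weights -/

/-- A finite weight on `M`, recorded by its values on positive operators, which is continuous
along increasing sequences. -/
structure IsSigmaNormal (M : VonNeumannAlgebra H) (φ : (H →L[ℂ] H) → ℝ≥0∞) : Prop where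
  add : ∀ x ∈ M, ∀ y ∈ M, 0 ≤ x → 0 ≤ y → φ (x + y) = φ x + φ y
  normal : ∀ f : ℕ → (H →L[ℂ] H), ∀ x, (∀ n, f n ∈ M) → (∀ n, 0 ≤ f n) → Monotone f →
    (∀ ξ, Tendsto (fun n => f n ξ) atTop (𝓝 (x ξ))) → φ x = ⨆ n, φ (f n)
  finite : φ 1 < ⊤

namespace IsSigmaNormal

variable {M : VonNeumannAlgebra H} {φ : (H →L[ℂ] H) → ℝ≥0∞}

lemma mono (hφ : IsSigmaNormal M φ) {x y : H →L[ℂ] H} (hx : x ∈ M) (hy : y ∈ M) (h0 : 0 ≤ x)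
    (hxy : x ≤ y) : φ x ≤ φ y := by
  have := hφ.add x hx (y - x) (sub_mem hy hx) h0 (sub_nonneg.2 hxy)
  rw [add_sub_cancel] at this
  exact this ▸ le_self_add

lemma lt_top (hφ : IsSigmaNormal M φ) {x : H →L[ℂ] H} (hx : x ∈ M) (h0 : 0 ≤ x) (h1 : x ≤ 1) :
    φ x < ⊤ :=
  (hφ.mono hx (one_mem M) h0 h1).trans_lt hφ.finite

lemma map_zero (hφ : IsSigmaNormal M φ) : φ 0 = 0 := by
  have h := hφ.add 0 (zero_mem M) 0 (zero_mem M) le_rfl le_rfl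
  have hfin := (hφ.lt_top (zero_mem M) le_rfl zero_le_one).ne
  rw [add_zero] at h
  exact (ENNReal.add_right_inj hfin).1 (by rw [← h, add_zero])

lemma map_sum (hφ : IsSigmaNormal M φ) {ι : Type*} (s : Finset ι) {a : ι → H →L[ℂ] H}
    (ha : ∀ i ∈ s, a i ∈ M) (h0 : ∀ i ∈ s, 0 ≤ a i) :
    φ (∑ i ∈ s, a i) = ∑ i ∈ s, φ (a i) := by
  classical
  induction s using Finset.induction_on with
  | empty => simp [hφ.map_zero]
  | insert i s hi ih =>
    rw [Finset.forall_mem_insert] at ha h0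
    rw [Finset.sum_insert hi, Finset.sum_insert hi, hφ.add _ ha.1 _ (sum_mem ha.2) h0.1
      (Finset.sum_nonneg h0.2), ih ha.2 h0.2]

/-- A sequentially normal finite weight is continuous along decreasing sequences. -/
lemma tendsto_of_antitone (hφ : IsSigmaNormal M φ) {f : ℕ → H →L[ℂ] H} {x : H →L[ℂ] H}
    (hf : ∀ n, f n ∈ M) (h0 : ∀ n, 0 ≤ f n) (h1 : ∀ n, f n ≤ 1) (hanti : Antitone f)
    (hx : ∀ ξ, Tendsto (fun n => f n ξ) atTop (𝓝 (x ξ))) :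
    Tendsto (fun n => φ (f n)) atTop (𝓝 (φ x)) := by
  have hxM : x ∈ M := mem_of_tendsto_apply hf hx
  have hx0 : 0 ≤ x := ge_of_tendsto_apply hx h0
  have hx1 : x ≤ 1 := le_of_tendsto_apply hx h1
  have hcompl : ∀ y ∈ M, 0 ≤ y → y ≤ 1 → φ 1 - φ (1 - y) = φ y := by
    intro y hy hy0 hy1
    have h := hφ.add y hy (1 - y) (sub_mem (one_mem M) hy) hy0 (sub_nonneg.2 hy1)
    rw [add_sub_cancel] at h
    rw [h]
    refine ENNReal.add_sub_cancel_right (hφ.lt_top (sub_mem (one_mem M) hy) (sub_nonneg.2 hy1)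
      (sub_le_self _ hy0)).ne
  have hmono : Monotone fun n => 1 - f n := fun n m h => sub_le_sub_left (hanti h) _
  have hM : ∀ n, 1 - f n ∈ M := fun n => sub_mem (one_mem M) (hf n)
  have hpos : ∀ n, 0 ≤ 1 - f n := fun n => sub_nonneg.2 (h1 n)
  have hsup := hφ.normal (fun n => 1 - f n) (1 - x) hM hpos hmono
    fun ξ => by simpa using tendsto_const_nhds.sub (hx ξ)
  have hlim : Tendsto (fun n => φ (1 - f n)) atTop (𝓝 (φ (1 - x))) := by
    rw [hsup]
    exact tendsto_atTop_iSup fun n m h => hφ.mono (hM n) (hM m) (hpos n) (hmono h)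
  have := ENNReal.Tendsto.sub (tendsto_const_nhds (x := φ 1)) hlim (.inl hφ.finite.ne)
  rw [hcompl x hxM hx0 hx1] at this
  exact this.congr fun n => hcompl _ (hf n) (h0 n) (h1 n)

/-- If a sequentially normal finite weight `ψ` is absolutely continuous with respect to a sequence
of such weights, then it tends to zero along sequences in the unit interval on which these decay
geometrically. -/
theorem tendsto_zero_of_absolutelyContinuous {φ : ℕ → (H →L[ℂ] H) → ℝ≥0∞}
    {ψ : (H →L[ℂ] H) → ℝ≥0∞} (hφ : ∀ i, IsSigmaNormal M (φ i)) (hψ : IsSigmaNormal M ψ)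
    (habs : ∀ a ∈ M, 0 ≤ a → (∀ i, φ i a = 0) → ψ a = 0) {a : ℕ → H →L[ℂ] H}
    (haM : ∀ n, a n ∈ M) (ha0 : ∀ n, 0 ≤ a n) (ha1 : ∀ n, a n ≤ 1)
    (hle : ∀ i n, i ≤ n → φ i (a n) ≤ 2⁻¹ ^ n) :
    Tendsto (fun n => ψ (a n)) atTop (𝓝 0) := by
  set S : ℕ → ℕ → H →L[ℂ] H := fun m J => ∑ j ∈ Finset.range J, a (m + j) with hS
  have hSM : ∀ m J, S m J ∈ M := fun m J => sum_mem fun _ _ => haM _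
  have hS0 : ∀ m J, 0 ≤ S m J := fun m J => Finset.sum_nonneg fun _ _ => ha0 _
  have hSmono : ∀ m, Monotone (S m) := fun m => monotone_nat_of_le_succ fun J => by
    simp only [hS, Finset.sum_range_succ]
    exact le_add_of_nonneg_right (ha0 _)
  have hSsucc : ∀ m J, S (m + 1) J ≤ S m (J + 1) := fun m J => by
    simp only [hS, Finset.sum_range_succ', add_zero]
    refine le_add_of_le_of_nonneg (Finset.sum_le_sum fun j _ => ?_) (ha0 _)
    rw [add_assoc, add_comm 1 j]
  set c : ℕ → ℕ → H →L[ℂ] H := fun m J => contraction (S m J) with hc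
  have hcM : ∀ m J, c m J ∈ M := fun m J => contraction_mem (hSM m J)
  have hcmono : ∀ m, Monotone (c m) := fun m J J' h => contraction_mono (hS0 m J) (hSmono m h)
  choose g hg using fun m => exists_tendsto_apply_of_monotone
    (fun J => contraction_nonneg (S m J)) (fun J => contraction_le_one (S m J)) (hcmono m)
  have hgM : ∀ m, g m ∈ M := fun m => mem_of_tendsto_apply (hcM m) (hg m)
  have hg0 : ∀ m, 0 ≤ g m := fun m => ge_of_tendsto_apply (hg m) fun J => contraction_nonneg _
  have hg1 : ∀ m, g m ≤ 1 := fun m => le_of_tendsto_apply (hg m) fun J => contraction_le_one _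
  have hcg : ∀ m J, c m J ≤ g m := fun m J => by
    refine ge_of_tendsto_apply (f := fun n => c m (n + J)) (fun ξ => ?_)
      fun n => hcmono m (Nat.le_add_left _ _)
    exact (tendsto_add_atTop_iff_nat (f := fun n => c m n ξ) J).2 (hg m ξ)
  have hganti : Antitone g := antitone_nat_of_succ_le fun m => le_of_tendsto_apply (hg (m + 1))
    fun J => (contraction_mono (hS0 _ _) (hSsucc m J)).trans (hcg m (J + 1))
  have hag : ∀ m, a m ≤ g m + g m := fun m => by
    have h1 : c m 1 = contraction (a m) := by simp [hc, hS]
    have h2 := hcg m 1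
    rw [h1] at h2
    exact (le_contraction_add_contraction (ha0 m) (ha1 m)).trans (add_le_add h2 h2)
  obtain ⟨h, hh⟩ := exists_tendsto_apply_of_monotone (f := fun m => 1 - g m)
    (fun m => sub_nonneg.2 (hg1 m)) (fun m => sub_le_self _ (hg0 m))
    fun m m' hm => sub_le_sub_left (hganti hm) _
  have hlim : ∀ ξ, Tendsto (fun m => g m ξ) atTop (𝓝 ((1 - h) ξ)) := fun ξ => by
    simpa using (tendsto_const_nhds (x := ξ)).sub (hh ξ)
  have hφg : ∀ i m, i ≤ m → φ i (g m) ≤ 2⁻¹ ^ m * 2 := by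
    intro i m him
    rw [(hφ i).normal (c m) (g m) (hcM m) (fun J => contraction_nonneg _) (hcmono m) (hg m)]
    refine iSup_le fun J => ?_
    calc φ i (c m J) ≤ φ i (S m J) :=
          (hφ i).mono (hcM m J) (hSM m J) (contraction_nonneg _) (contraction_le_self (hS0 m J))
      _ = ∑ j ∈ Finset.range J, φ i (a (m + j)) :=
          (hφ i).map_sum _ (fun _ _ => haM _) fun _ _ => ha0 _
      _ ≤ ∑ j ∈ Finset.range J, 2⁻¹ ^ m * 2⁻¹ ^ j :=
          Finset.sum_le_sum fun j _ => by
            rw [← pow_add]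
            exact hle i _ (him.trans (Nat.le_add_right _ _))
      _ ≤ 2⁻¹ ^ m * ∑' j, 2⁻¹ ^ j := by
          rw [← Finset.mul_sum]
          gcongr
          exact ENNReal.sum_le_tsum _
      _ = 2⁻¹ ^ m * 2 := by
          rw [ENNReal.tsum_geometric, ENNReal.one_sub_inv_two, inv_inv]
  have hzero : ψ (1 - h) = 0 := by
    refine habs _ (mem_of_tendsto_apply hgM hlim) (ge_of_tendsto_apply hlim hg0) fun i => ?_
    have h1 := (hφ i).tendsto_of_antitone hgM hg0 hg1 hganti hlim
    have h2 : Tendsto (fun m : ℕ => (2⁻¹ : ℝ≥0∞) ^ m * 2) atTop (𝓝 0) := by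
      have := ENNReal.Tendsto.mul_const (b := 2)
        (ENNReal.tendsto_pow_atTop_nhds_zero_of_lt_one (r := 2⁻¹) (by simp)) (.inr (by simp))
      simpa using this
    exact tendsto_nhds_unique h1 (tendsto_of_tendsto_of_tendsto_of_le_of_le' tendsto_const_nhds h2
      (Eventually.of_forall fun _ => zero_le) ((eventually_ge_atTop i).mono fun m hm => hφg i m hm))
  have h1 := hψ.tendsto_of_antitone hgM hg0 hg1 hganti hlim
  rw [hzero] at h1
  have h2 : Tendsto (fun m => ψ (g m) + ψ (g m)) atTop (𝓝 0) := by simpa using h1.add h1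
  refine tendsto_of_tendsto_of_tendsto_of_le_of_le tendsto_const_nhds h2 (fun _ => zero_le)
    fun m => ?_
  change ψ (a m) ≤ ψ (g m) + ψ (g m)
  rw [← hψ.add _ (hgM m) _ (hgM m) (hg0 m) (hg0 m)]
  exact hψ.mono (haM m) (add_mem (hgM m) (hgM m)) (ha0 m) (hag m)

/-- Absolute continuity of sequentially normal finite weights on the unit interval, in uniform
form. -/
theorem exists_forall_lt_of_absolutelyContinuous {φ : ℕ → (H →L[ℂ] H) → ℝ≥0∞}
    {ψ : (H →L[ℂ] H) → ℝ≥0∞} (hφ : ∀ i, IsSigmaNormal M (φ i)) (hψ : IsSigmaNormal M ψ)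
    (habs : ∀ a ∈ M, 0 ≤ a → (∀ i, φ i a = 0) → ψ a = 0) {ε : ℝ≥0∞} (hε : 0 < ε) :
    ∃ n : ℕ, ∀ a ∈ M, 0 ≤ a → a ≤ 1 → (∀ i ≤ n, φ i a ≤ 2⁻¹ ^ n) → ψ a < ε := by
  by_contra! hcon
  choose a haM ha0 ha1 hle hge using hcon
  obtain ⟨n, hn⟩ := ((tendsto_zero_of_absolutelyContinuous hφ hψ habs haM ha0 ha1
    fun i n hi => hle n i hi).eventually_lt_const hε).exists
  exact (hge n).not_gt hn

end IsSigmaNormal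

/-! ### Homomorphisms of von Neumann algebras -/

lemma exists_selfAdjoint_mul_self {M : VonNeumannAlgebra H} {x : H →L[ℂ] H} (hx : x ∈ M)
    (h0 : 0 ≤ x) : ∃ s ∈ M, star s = s ∧ s * s = x :=
  ⟨CFC.sqrt x, mem_of_commute fun _ hy => ((commute_of_mem hx hy).symm.cfcₙ_nnreal _).symm,
    (IsSelfAdjoint.of_nonneg (CFC.sqrt_nonneg x)).star_eq, CFC.sqrt_mul_sqrt_self x h0⟩

lemma IsProjectionOp.conjugate_nonneg {p a : H →L[ℂ] H} (hp : IsProjectionOp p) (ha : 0 ≤ a) :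
    0 ≤ p * a * p :=
  IsSelfAdjoint.conjugate_nonneg ha hp.2

lemma isProjectionOp_le_one {p : H →L[ℂ] H} (hp : IsProjectionOp p) : p ≤ 1 :=
  IsStarProjection.le_one ⟨hp.1, hp.2⟩

lemma isProjectionOp_nonneg {p : H →L[ℂ] H} (hp : IsProjectionOp p) : 0 ≤ p :=
  IsStarProjection.nonneg ⟨hp.1, hp.2⟩

lemma star_mul_self_le_one {x : H →L[ℂ] H} (hx : ‖x‖ ≤ 1) : star x * x ≤ 1 := by
  rw [← CStarAlgebra.norm_le_one_iff_of_nonneg _ (star_mul_self_nonneg x),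
    CStarRing.norm_star_mul_self]
  exact mul_le_one₀ hx (norm_nonneg x) hx

lemma norm_le_one_of_star_mul_self_le_one {x : H →L[ℂ] H} (hx : star x * x ≤ 1) : ‖x‖ ≤ 1 := by
  rw [← CStarAlgebra.norm_le_one_iff_of_nonneg _ (star_mul_self_nonneg x),
    CStarRing.norm_star_mul_self] at hx
  nlinarith [norm_nonneg x]

namespace VNHom

variable {M : VonNeumannAlgebra H} {N : VonNeumannAlgebra K}

lemma map_zero (f : VNHom M N) : f.toFun 0 = 0 := by
  simpa using f.map_smul' 0 0 (zero_mem M)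

lemma map_sub (f : VNHom M N) {x y : H →L[ℂ] H} (hx : x ∈ M) (hy : y ∈ M) :
    f.toFun (x - y) = f.toFun x - f.toFun y := by
  rw [eq_sub_iff_add_eq, ← f.map_add' _ (sub_mem hx hy) _ hy, sub_add_cancel]

lemma map_star_mul_self (f : VNHom M N) {x : H →L[ℂ] H} (hx : x ∈ M) :
    f.toFun (star x * x) = star (f.toFun x) * f.toFun x := by
  rw [f.map_mul' _ (star_mem hx) _ hx, f.map_star' _ hx]

lemma map_nonneg (f : VNHom M N) {x : H →L[ℂ] H} (hx : x ∈ M) (h0 : 0 ≤ x) :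
    0 ≤ f.toFun x := by
  obtain ⟨s, hs, hsa, rfl⟩ := exists_selfAdjoint_mul_self hx h0
  nth_rw 1 [← hsa]
  rw [f.map_star_mul_self hs]
  exact star_mul_self_nonneg _

lemma map_mono (f : VNHom M N) {x y : H →L[ℂ] H} (hx : x ∈ M) (hy : y ∈ M) (h : x ≤ y) :
    f.toFun x ≤ f.toFun y := by
  rw [← sub_nonneg, ← f.map_sub hy hx]
  exact f.map_nonneg (sub_mem hy hx) (sub_nonneg.2 h)

lemma isProjectionOp_map (f : VNHom M N) {p : H →L[ℂ] H} (hp : p ∈ M) (h : IsProjectionOp p) :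
    IsProjectionOp (f.toFun p) :=
  ⟨by rw [← f.map_mul' _ hp _ hp, h.1], by rw [← f.map_star' _ hp, h.2]⟩

lemma norm_map_le_one (f : VNHom M N) {x : H →L[ℂ] H} (hx : x ∈ M) (h : ‖x‖ ≤ 1) :
    ‖f.toFun x‖ ≤ 1 := by
  refine norm_le_one_of_star_mul_self_le_one ?_
  rw [← f.map_star_mul_self hx]
  exact (f.map_mono (mul_mem (star_mem hx) hx) (one_mem M) (star_mul_self_le_one h)).trans
    (isProjectionOp_le_one (f.isProjectionOp_map (one_mem M) ⟨one_mul 1, star_one _⟩))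

section Bijective

variable {θ : VNHom M N}

lemma map_one_of_bijOn
    (hθ : Set.BijOn θ.toFun (M : Set (H →L[ℂ] H)) (N : Set (K →L[ℂ] K))) :
    θ.toFun 1 = 1 := by
  obtain ⟨u, hu, hu1⟩ := hθ.surjOn (one_mem N)
  have h := θ.map_mul' 1 (one_mem M) u hu
  rwa [hu1, one_mul, hu1, mul_one, eq_comm] at h

lemma eq_zero_of_bijOn
    (hθ : Set.BijOn θ.toFun (M : Set (H →L[ℂ] H)) (N : Set (K →L[ℂ] K)))
    {x : H →L[ℂ] H} (hx : x ∈ M) (h : θ.toFun x = 0) : x = 0 :=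
  hθ.injOn hx (zero_mem M) (h.trans θ.map_zero.symm)

lemma nonneg_of_bijOn
    (hθ : Set.BijOn θ.toFun (M : Set (H →L[ℂ] H)) (N : Set (K →L[ℂ] K)))
    {x : H →L[ℂ] H} (hx : x ∈ M) (h0 : 0 ≤ θ.toFun x) : 0 ≤ x := by
  obtain ⟨s, hs, hsa, hss⟩ := exists_selfAdjoint_mul_self (θ.mem' x hx) h0
  obtain ⟨t, ht, rfl⟩ := hθ.surjOn hs
  have h1 : star t = t := hθ.injOn (star_mem ht) ht (by rw [θ.map_star' t ht, hsa])
  have h2 : t * t = x := hθ.injOn (mul_mem ht ht) hx (by rw [θ.map_mul' t ht t ht, hss])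
  rw [← h2]
  nth_rw 1 [← h1]
  exact star_mul_self_nonneg t

lemma le_of_bijOn
    (hθ : Set.BijOn θ.toFun (M : Set (H →L[ℂ] H)) (N : Set (K →L[ℂ] K)))
    {x y : H →L[ℂ] H} (hx : x ∈ M) (hy : y ∈ M) (h : θ.toFun x ≤ θ.toFun y) :
    x ≤ y := by
  rw [← sub_nonneg]
  refine nonneg_of_bijOn hθ (sub_mem hy hx) ?_
  rw [θ.map_sub hy hx]
  exact sub_nonneg.2 h

end Bijective

end VNHom

lemma le_of_monotone_of_tendsto_apply {f : ℕ → H →L[ℂ] H} {x : H →L[ℂ] H} (hmono : Monotone f)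
    (hx : ∀ ξ, Tendsto (fun n => f n ξ) atTop (𝓝 (x ξ))) (n : ℕ) : f n ≤ x :=
  ge_of_tendsto_apply (f := fun m => f (n + m))
    (fun ξ => (hx ξ).comp (tendsto_add_atTop_nat n |>.congr fun _ => add_comm _ _))
    fun m => hmono (Nat.le_add_right n m)

lemma exists_tendsto_apply_of_monotone_of_le {f : ℕ → H →L[ℂ] H} {y : H →L[ℂ] H}
    (h0 : ∀ n, 0 ≤ f n) (h1 : ∀ n, f n ≤ y) (hmono : Monotone f) :
    ∃ x : H →L[ℂ] H, ∀ ξ, Tendsto (fun n => f n ξ) atTop (𝓝 (x ξ)) := by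
  have hy : 0 ≤ y := (h0 0).trans (h1 0)
  have hc : 0 < ‖y‖ + 1 := by positivity
  have hc1 : ∀ n, (‖y‖ + 1)⁻¹ • f n ≤ 1 := fun n => by
    have hfn : ‖f n‖ ≤ ‖y‖ := CStarAlgebra.norm_le_norm_of_nonneg_of_le (h0 n) (h1 n)
    rw [← CStarAlgebra.norm_le_one_iff_of_nonneg _ (smul_nonneg (by positivity) (h0 n)), norm_smul,
      Real.norm_of_nonneg (by positivity), inv_mul_le_iff₀ hc]
    linarith
  obtain ⟨x, hx⟩ := exists_tendsto_apply_of_monotone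
    (fun n => smul_nonneg (by positivity) (h0 n)) hc1
    fun n m hnm => smul_le_smul_of_nonneg_left (hmono hnm) (by positivity)
  refine ⟨(‖y‖ + 1) • x, fun ξ => ((hx ξ).const_smul (‖y‖ + 1)).congr fun n => ?_⟩
  simp [smul_smul, hc.ne']

/-- A bijective homomorphism of von Neumann algebras is sequentially normal. -/
lemma VNHom.tendsto_apply_of_bijOn {M : VonNeumannAlgebra H} {N : VonNeumannAlgebra K}
    {θ : VNHom M N} (hθ : Set.BijOn θ.toFun (M : Set (H →L[ℂ] H)) (N : Set (K →L[ℂ] K)))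
    {f : ℕ → H →L[ℂ] H} {x : H →L[ℂ] H} (hf : ∀ n, f n ∈ M) (h0 : ∀ n, 0 ≤ f n)
    (hmono : Monotone f) (hx : ∀ ξ, Tendsto (fun n => f n ξ) atTop (𝓝 (x ξ))) (η : K) :
    Tendsto (fun n => θ.toFun (f n) η) atTop (𝓝 (θ.toFun x η)) := by
  have hxM : x ∈ M := mem_of_tendsto_apply hf hx
  have hfx := le_of_monotone_of_tendsto_apply hmono hx
  have hmono' : Monotone fun n => θ.toFun (f n) := fun n m hnm =>
    θ.map_mono (hf n) (hf m) (hmono hnm)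
  obtain ⟨b, hb⟩ := exists_tendsto_apply_of_monotone_of_le
    (fun n => θ.map_nonneg (hf n) (h0 n)) (fun n => θ.map_mono (hf n) hxM (hfx n)) hmono'
  obtain ⟨c, hc, rfl⟩ := hθ.surjOn (mem_of_tendsto_apply (fun n => θ.mem' _ (hf n)) hb)
  have h1 : x ≤ c := le_of_tendsto_apply hx fun n =>
    VNHom.le_of_bijOn hθ (hf n) hc (le_of_monotone_of_tendsto_apply hmono' hb n)
  have h2 : c ≤ x := VNHom.le_of_bijOn hθ hc hxM
    (le_of_tendsto_apply hb fun n => θ.map_mono (hf n) hxM (hfx n))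
  rw [le_antisymm h1 h2]
  exact hb η

lemma IsSigmaNormal.comp_of_bijOn {M : VonNeumannAlgebra H} {N : VonNeumannAlgebra K}
    {φ : (K →L[ℂ] K) → ℝ≥0∞} (hφ : IsSigmaNormal N φ) {θ : VNHom M N}
    (hθ : Set.BijOn θ.toFun (M : Set (H →L[ℂ] H)) (N : Set (K →L[ℂ] K))) :
    IsSigmaNormal M fun a => φ (θ.toFun a) where
  add x hx y hy hx0 hy0 := by
    rw [θ.map_add' x hx y hy, hφ.add _ (θ.mem' x hx) _ (θ.mem' y hy) (θ.map_nonneg hx hx0)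
      (θ.map_nonneg hy hy0)]
  normal f x hf h0 hmono hx :=
    hφ.normal _ _ (fun n => θ.mem' _ (hf n)) (fun n => θ.map_nonneg (hf n) (h0 n))
      (fun n m hnm => θ.map_mono (hf n) (hf m) (hmono hnm))
      (VNHom.tendsto_apply_of_bijOn hθ hf h0 hmono hx)
  finite := by rw [VNHom.map_one_of_bijOn hθ]; exact hφ.finite

lemma isSigmaNormal_vector (M : VonNeumannAlgebra H) (η : H) :
    IsSigmaNormal M fun a => ENNReal.ofReal (⟪a η, η⟫_ℂ).re where
  add x _ y _ hx hy := by
    rw [add_apply, inner_add_left, Complex.add_re, ENNReal.ofReal_add]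
    · exact ((ContinuousLinearMap.nonneg_iff_isPositive _).1 hx).re_inner_nonneg_left η
    · exact ((ContinuousLinearMap.nonneg_iff_isPositive _).1 hy).re_inner_nonneg_left η
  normal f x _ _ hmono hx := by
    refine tendsto_nhds_unique ?_ (tendsto_atTop_iSup fun n m hnm => ENNReal.ofReal_le_ofReal ?_)
    · exact ENNReal.tendsto_ofReal
        ((Complex.continuous_re.tendsto _).comp ((hx η).inner tendsto_const_nhds))
    · have := ((ContinuousLinearMap.le_def _ _).1 (hmono hnm)).re_inner_nonneg_left η
      simpa [inner_sub_left] using this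
  finite := ENNReal.ofReal_lt_top

lemma re_inner_star_mul_self (y : H →L[ℂ] H) (η : H) :
    (⟪(star y * y) η, η⟫_ℂ).re = ‖y η‖ ^ 2 := by
  rw [ContinuousLinearMap.mul_def, ContinuousLinearMap.comp_apply,
    ContinuousLinearMap.star_eq_adjoint, ContinuousLinearMap.adjoint_inner_left,
    inner_self_eq_norm_sq_to_K]
  norm_cast

lemma apply_eq_zero_of_vector_eq_zero {a : H →L[ℂ] H} (ha : 0 ≤ a) {η : H}
    (h : ENNReal.ofReal (⟪a η, η⟫_ℂ).re = 0) : a η = 0 := by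
  have h2 : star (CFC.sqrt a) * CFC.sqrt a = a := by
    rw [(IsSelfAdjoint.of_nonneg (CFC.sqrt_nonneg a)).star_eq, CFC.sqrt_mul_sqrt_self a ha]
  rw [← h2, re_inner_star_mul_self, ENNReal.ofReal_eq_zero] at h
  have h3 : CFC.sqrt a η = 0 := by
    rw [← norm_eq_zero]
    exact pow_eq_zero_iff two_ne_zero |>.1 (le_antisymm h (sq_nonneg _))
  rw [← h2, ContinuousLinearMap.mul_def, ContinuousLinearMap.comp_apply, h3, _root_.map_zero]

namespace FNSTrace

variable {N : VonNeumannAlgebra K}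

lemma isSigmaNormal_compression (τ : FNSTrace N) {q : K →L[ℂ] K} (hq : q ∈ N)
    (hproj : IsProjectionOp q) (hfin : τ.toFun q < ⊤) :
    IsSigmaNormal N fun a => τ.toFun (q * a * q) where
  add x hx y hy hx0 hy0 := by
    rw [mul_add, add_mul, τ.map_add' _ (mul_mem (mul_mem hq hx) hq) _ (mul_mem (mul_mem hq hy) hq)]
    · rw [← ContinuousLinearMap.nonneg_iff_isPositive]
      exact hproj.conjugate_nonneg hx0
    · rw [← ContinuousLinearMap.nonneg_iff_isPositive]
      exact hproj.conjugate_nonneg hy0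
  normal f x hf h0 hmono hx := by
    refine τ.normal' _ _ (mul_mem (mul_mem hq (mem_of_tendsto_apply hf hx)) hq) (fun n =>
      ⟨mul_mem (mul_mem hq (hf n)) hq, ?_⟩) (fun n => ?_) fun ξ => ?_
    · rw [← ContinuousLinearMap.nonneg_iff_isPositive]
      exact hproj.conjugate_nonneg (h0 n)
    · rw [← ContinuousLinearMap.nonneg_iff_isPositive, ← sub_mul, ← mul_sub]
      exact hproj.conjugate_nonneg (sub_nonneg.2 (hmono n.le_succ))
    · exact (q.continuous.tendsto _).comp (hx (q ξ))
  finite := by rwa [mul_one, hproj.1]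

lemma mono (τ : FNSTrace N) {x y : K →L[ℂ] K} (hx : x ∈ N) (hy : y ∈ N) (h0 : 0 ≤ x)
    (hxy : x ≤ y) : τ.toFun x ≤ τ.toFun y := by
  have := τ.map_add' x hx (y - x) (sub_mem hy hx)
    ((ContinuousLinearMap.nonneg_iff_isPositive _).1 h0) ((ContinuousLinearMap.le_def _ _).1 hxy)
  rw [add_sub_cancel] at this
  exact this ▸ le_self_add

/-- A positive element whose compression by a projection has zero trace is annihilated by it. -/
lemma mul_eq_zero_of_compression_eq_zero (τ : FNSTrace N) {q a : K →L[ℂ] K} (hq : q ∈ N)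
    (hproj : IsProjectionOp q) (ha : a ∈ N) (h0 : 0 ≤ a) (h : τ.toFun (q * a * q) = 0) :
    a * q = 0 := by
  obtain ⟨s, hs, hsa, rfl⟩ := exists_selfAdjoint_mul_self ha h0
  have h1 := τ.faithful' _ (mul_mem (mul_mem hq ha) hq)
    ((ContinuousLinearMap.nonneg_iff_isPositive _).1 (hproj.conjugate_nonneg h0)) h
  have h2 : star (s * q) * (s * q) = 0 := by
    rw [star_mul, hsa, hproj.2, ← h1]
    noncomm_ring
  rw [mul_assoc, (CStarRing.star_mul_self_eq_zero_iff _).1 h2, mul_zero]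

/-- Compressing by a projection on the right does not increase the trace norm. -/
lemma compression_star_mul_self_le (τ : FNSTrace N) {q e : K →L[ℂ] K} (hq : q ∈ N)
    (hproj : IsProjectionOp q) (he : e ∈ N) :
    τ.toFun (q * (star e * e) * q) ≤ τ.toFun (star e * e) := by
  have h1 : q * (star e * e) * q = star (e * q) * (e * q) := by
    rw [star_mul, hproj.2]
    noncomm_ring
  have h2 : e * q * star (e * q) = e * q * star e := by
    rw [star_mul, hproj.2, ← mul_assoc, mul_assoc e q q, hproj.1]
  rw [h1, τ.tracial' _ (mul_mem he hq), h2, τ.tracial' _ he]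
  refine τ.mono (mul_mem (mul_mem he hq) (star_mem he)) (mul_mem he (star_mem he))
    (star_right_conjugate_nonneg (isProjectionOp_nonneg hproj) e) ?_
  have := star_right_conjugate_le_conjugate (isProjectionOp_le_one hproj) e
  rwa [mul_one] at this

end FNSTrace

/-! ### Countable separating families of vectors -/

/-- The closed subspace generated by a vector under the commutant. -/
def cyclicSubspace (M : VonNeumannAlgebra H) (ξ : H) : Submodule ℂ H :=
  (Submodule.span ℂ {η | ∃ m ∈ M.commutant, η = m ξ}).topologicalClosure

instance (M : VonNeumannAlgebra H) (ξ : H) : CompleteSpace (cyclicSubspace M ξ) :=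
  inferInstanceAs (CompleteSpace (Submodule.topologicalClosure _))

section Cyclic

variable {M : VonNeumannAlgebra H}

lemma mem_cyclicSubspace (M : VonNeumannAlgebra H) (ξ : H) : ξ ∈ cyclicSubspace M ξ :=
  Submodule.le_topologicalClosure _ (Submodule.subset_span ⟨1, one_mem _, rfl⟩)

lemma cyclicSubspace_le {ξ : H} {V : Submodule ℂ H} (hV : IsClosed (V : Set H))
    (h : ∀ m ∈ M.commutant, m ξ ∈ V) : cyclicSubspace M ξ ≤ V := by
  refine Submodule.topologicalClosure_minimal _ (Submodule.span_le.2 ?_) hV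
  rintro _ ⟨m, hm, rfl⟩
  exact h m hm

lemma apply_mem_cyclicSubspace {ξ η : H} {m : H →L[ℂ] H} (hm : m ∈ M.commutant)
    (hη : η ∈ cyclicSubspace M ξ) : m η ∈ cyclicSubspace M ξ := by
  have hle : cyclicSubspace M ξ ≤ (cyclicSubspace M ξ).comap m.toLinearMap :=
    cyclicSubspace_le ((Submodule.isClosed_topologicalClosure _).preimage m.continuous)
      fun m' hm' => Submodule.le_topologicalClosure _
        (Submodule.subset_span ⟨m * m', mul_mem hm hm', rfl⟩)
  exact hle hη

lemma isOrtho_cyclicSubspace {ξ ζ : H} (h : ∀ m ∈ M.commutant, ⟪m ξ, ζ⟫_ℂ = 0) :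
    cyclicSubspace M ξ ⟂ cyclicSubspace M ζ := by
  refine cyclicSubspace_le (Submodule.isClosed_orthogonal _) fun m hm => ?_
  have hle : cyclicSubspace M ζ ≤ (ℂ ∙ m ξ)ᗮ :=
    cyclicSubspace_le (Submodule.isClosed_orthogonal _) fun m' hm' => by
      rw [Submodule.mem_orthogonal_singleton_iff_inner_right,
        ← ContinuousLinearMap.adjoint_inner_left, ← ContinuousLinearMap.star_eq_adjoint]
      exact h (star m' * m) (mul_mem (star_mem hm') hm)
  rw [Submodule.mem_orthogonal']
  exact fun η hη => Submodule.mem_orthogonal_singleton_iff_inner_right.1 (hle hη)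

/-- The projection onto the cyclic subspace of a vector belongs to the algebra. -/
lemma starProjection_cyclicSubspace_mem (M : VonNeumannAlgebra H) (ξ : H) :
    (cyclicSubspace M ξ).starProjection ∈ M := by
  rw [VonNeumannAlgebra.IsStarProjection.mem_iff isStarProjection_starProjection]
  intro y hy
  rw [Submodule.range_starProjection]
  exact fun η hη => apply_mem_cyclicSubspace hy hη

lemma sum_starProjection_le_one {ι : Type*} {V : ι → Submodule ℂ H}
    [∀ i, (V i).HasOrthogonalProjection] (s : Finset ι)
    (h : (s : Set ι).Pairwise fun i j => V i ⟂ V j) :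
    ∑ i ∈ s, (V i).starProjection ≤ 1 := by
  classical
  suffices IsStarProjection (∑ i ∈ s, (V i).starProjection) from this.le_one
  induction s using Finset.induction_on with
  | empty => simp
  | insert i s hi ih =>
    rw [Finset.coe_insert, Set.pairwise_insert] at h
    rw [Finset.sum_insert hi]
    refine isStarProjection_starProjection.add (ih h.1) ?_
    rw [Finset.mul_sum]
    refine Finset.sum_eq_zero fun j hj => ?_
    exact (h.2 j hj (ne_of_mem_of_not_mem hj hi).symm).1.starProjection_comp_starProjection

lemma countable_of_pairwise_isOrtho {φ : ℕ → (H →L[ℂ] H) → ℝ≥0∞}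
    (hφ : ∀ k, IsSigmaNormal M (φ k))
    (hsep : ∀ a ∈ M, 0 ≤ a → (∀ k, φ k a = 0) → a = 0) {S : Set H} (h0 : ∀ ξ ∈ S, ξ ≠ 0)
    (hS : S.Pairwise fun ξ ζ => ∀ m ∈ M.commutant, ⟪m ξ, ζ⟫_ℂ = 0) : S.Countable := by
  set e : S → H →L[ℂ] H := fun ξ => (cyclicSubspace M ξ).starProjection with he
  have heM : ∀ ξ, e ξ ∈ M := fun ξ => starProjection_cyclicSubspace_mem M ξ
  have he0 : ∀ ξ, 0 ≤ e ξ := fun ξ => isStarProjection_starProjection.nonneg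
  have hcount : ∀ k, (Function.support fun ξ => φ k (e ξ)).Countable := fun k => by
    refine Summable.countable_support_ennreal (ne_top_of_le_ne_top (hφ k).finite.ne ?_)
    rw [ENNReal.tsum_eq_iSup_sum]
    refine iSup_le fun s => ?_
    rw [← (hφ k).map_sum s (fun ξ _ => heM ξ) fun ξ _ => he0 ξ]
    refine (hφ k).mono (sum_mem fun ξ _ => heM ξ) (one_mem M) (Finset.sum_nonneg fun ξ _ => he0 ξ)
      (sum_starProjection_le_one s fun ξ _ ζ _ hne => isOrtho_cyclicSubspace ?_)
    exact hS ξ.2 ζ.2 fun h => hne (Subtype.ext h)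
  rw [← Set.countable_coe_iff, ← Set.countable_univ_iff]
  refine (Set.countable_iUnion hcount).mono fun ξ _ => ?_
  by_contra hξ
  simp only [Set.mem_iUnion, Function.mem_support, not_exists, not_not] at hξ
  have h1 : (cyclicSubspace M (ξ : H)).starProjection (ξ : H) = ξ :=
    Submodule.starProjection_eq_self_iff.2 (mem_cyclicSubspace M _)
  refine h0 ξ ξ.2 ?_
  rw [← h1]
  exact congr($(hsep _ (heM ξ) (he0 ξ) hξ) (ξ : H))

/-- A von Neumann algebra with a countable separating family of sequentially normal finite weights
has a countable separating family of vectors. -/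
lemma exists_separating_sequence {φ : ℕ → (H →L[ℂ] H) → ℝ≥0∞}
    (hφ : ∀ k, IsSigmaNormal M (φ k))
    (hsep : ∀ a ∈ M, 0 ≤ a → (∀ k, φ k a = 0) → a = 0) :
    ∃ ξ : ℕ → H, ∀ a ∈ M, (∀ i, a (ξ i) = 0) → a = 0 := by
  obtain ⟨S, hS⟩ := zorn_subset {S : Set H | (∀ ξ ∈ S, ξ ≠ 0) ∧
      S.Pairwise fun ξ ζ => ∀ m ∈ M.commutant, ⟪m ξ, ζ⟫_ℂ = 0} (by
    intro c hc hchain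
    refine ⟨⋃₀ c, ⟨?_, (Set.pairwise_sUnion hchain.directedOn).2 fun s hs => (hc hs).2⟩,
      fun s hs => Set.subset_sUnion_of_mem hs⟩
    rintro ξ ⟨s, hs, hξ⟩
    exact (hc hs).1 ξ hξ)
  have hcount : (insert 0 S).Countable :=
    (countable_of_pairwise_isOrtho hφ hsep hS.prop.1 hS.prop.2).insert 0
  obtain ⟨ξ, hξ⟩ := hcount.exists_eq_range (Set.insert_nonempty _ _)
  refine ⟨ξ, fun a ha haξ => ?_⟩
  have haS : ∀ ζ ∈ S, a ζ = 0 := fun ζ hζ => by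
    obtain ⟨i, rfl⟩ : ζ ∈ Set.range ξ := hξ ▸ Set.mem_insert_of_mem 0 hζ
    exact haξ i
  by_contra hne
  obtain ⟨v, hv⟩ : ∃ v, star a v ≠ 0 := by
    by_contra! h
    exact hne (star_eq_zero.1 (ContinuousLinearMap.ext h))
  have horth : ∀ ζ ∈ S, ∀ m ∈ M.commutant, ⟪m ζ, star a v⟫_ℂ = 0 := fun ζ hζ m hm => by
    rw [ContinuousLinearMap.star_eq_adjoint, ContinuousLinearMap.adjoint_inner_right]
    have : a (m ζ) = m (a ζ) := congr($((commute_of_mem ha hm).symm) ζ)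
    rw [this, haS ζ hζ, _root_.map_zero, inner_zero_left]
  have hmem : star a v ∈ S := by
    refine hS.le_of_ge ⟨?_, hS.prop.2.insert fun ζ hζ _ => ⟨fun m hm => ?_, horth ζ hζ⟩⟩
      (Set.subset_insert (star a v) S) (Set.mem_insert _ _)
    · rintro ζ (rfl | hζ)
      exacts [hv, hS.prop.1 ζ hζ]
    · rw [← ContinuousLinearMap.adjoint_inner_right, ← inner_conj_symm,
        ← ContinuousLinearMap.star_eq_adjoint, horth ζ hζ _ (star_mem hm), _root_.map_zero]
  exact hv (inner_self_eq_zero.1 (horth _ hmem 1 (one_mem _)))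

end Cyclic

/-! ### Approximation by a strongly dense set -/

section Separating

variable {M : VonNeumannAlgebra H} {ξ : ℕ → H}

lemma IsSigmaNormal.exists_forall_lt_of_separating
    (hξ : ∀ a ∈ M, (∀ i, a (ξ i) = 0) → a = 0)
    {ψ : (H →L[ℂ] H) → ℝ≥0∞}
    (hψ : IsSigmaNormal M ψ) {ε : ℝ≥0∞} (hε : 0 < ε) :
    ∃ n : ℕ, ∀ a ∈ M, 0 ≤ a → a ≤ 1 →
      (∀ i ≤ n, ENNReal.ofReal (⟪a (ξ i), ξ i⟫_ℂ).re ≤ 2⁻¹ ^ n) → ψ a < ε := by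
  refine exists_forall_lt_of_absolutelyContinuous (fun i => isSigmaNormal_vector M (ξ i)) hψ
    (fun a ha h0 h => ?_) hε
  rw [hξ a ha fun i => apply_eq_zero_of_vector_eq_zero h0 (h i), hψ.map_zero]

lemma IsSigmaNormal.exists_mem_lt_of_separating
    (hξ : ∀ a ∈ M, (∀ i, a (ξ i) = 0) → a = 0)
    {X : Set (H →L[ℂ] H)}
    (hX : X ⊆ {x | x ∈ M ∧ ‖x‖ ≤ 1})
    (hXdense : ∀ x ∈ M, ‖x‖ ≤ 1 → ∀ ε : ℝ, 0 < ε → ∀ s : Finset H,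
      ∃ y ∈ X, ∀ ξ ∈ s, ‖(x - y) ξ‖ < ε)
    {ψ : (H →L[ℂ] H) → ℝ≥0∞} (hψ : IsSigmaNormal M ψ) {ε : ℝ≥0∞} (hε : 0 < ε)
    {x : H →L[ℂ] H} (hx : x ∈ M) (hx1 : ‖x‖ ≤ 1) :
    ∃ y ∈ X, ∃ d ∈ M, ‖d‖ ≤ 1 ∧ x = (2 : ℂ) • d + y ∧ ψ (star d * d) < ε := by
  classical
  obtain ⟨n, hn⟩ := hψ.exists_forall_lt_of_separating hξ hε
  obtain ⟨y, hyX, hy⟩ := hXdense x hx hx1 (2⁻¹ ^ n) (by positivity)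
    ((Finset.range (n + 1)).image ξ)
  obtain ⟨hyM, hy1⟩ := hX hyX
  have hd1 : ‖(2⁻¹ : ℂ) • (x - y)‖ ≤ 1 := by
    rw [norm_smul, norm_inv, Complex.norm_ofNat, inv_mul_le_iff₀ two_pos]
    linarith [norm_sub_le x y]
  have hdM : (2⁻¹ : ℂ) • (x - y) ∈ M := smul_mem_vonNeumann M _ (sub_mem hx hyM)
  refine ⟨y, hyX, _, hdM, hd1, ?_, hn _ (mul_mem (star_mem hdM) hdM) (star_mul_self_nonneg _)
    (star_mul_self_le_one hd1) fun i hi => ?_⟩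
  · rw [smul_smul, mul_inv_cancel₀ two_ne_zero, one_smul, sub_add_cancel]
  · have h1 : ‖((2⁻¹ : ℂ) • (x - y)) (ξ i)‖ ≤ 2⁻¹ ^ n := by
      have h2 := hy (ξ i) (Finset.mem_image_of_mem _ (Finset.mem_range.2 (by omega)))
      rw [smul_apply, norm_smul, norm_inv, Complex.norm_ofNat, inv_mul_le_iff₀ two_pos]
      linarith [norm_nonneg ((x - y) (ξ i))]
    have h3 : (2⁻¹ : ℝ≥0∞) ^ n = ENNReal.ofReal (2⁻¹ ^ n) := by
      rw [ENNReal.ofReal_pow (by norm_num), ENNReal.ofReal_inv_of_pos two_pos]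
      norm_num
    rw [re_inner_star_mul_self, h3]
    refine ENNReal.ofReal_le_ofReal ((pow_le_of_le_one (norm_nonneg _) ?_ two_ne_zero).trans h1)
    exact h1.trans (pow_le_one₀ (by norm_num) (by norm_num))

/-- An isomorphism preserves strong convergence to one of a sequence of projections. -/
lemma VNHom.tendsto_apply_of_isProjectionOp
    (hξ : ∀ a ∈ M, (∀ i, a (ξ i) = 0) → a = 0)
    {N : VonNeumannAlgebra K} {θ : VNHom M N}
    (hθ : Set.BijOn θ.toFun (M : Set (H →L[ℂ] H)) (N : Set (K →L[ℂ] K)))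
    {p : ℕ → H →L[ℂ] H} (hpM : ∀ k, p k ∈ M) (hproj : ∀ k, IsProjectionOp (p k))
    (hp1 : ∀ ζ : H, Tendsto (fun k => p k ζ) atTop (𝓝 ζ)) (η : K) :
    Tendsto (fun k => θ.toFun (p k) η) atTop (𝓝 η) := by
  rw [Metric.tendsto_nhds]
  intro ε hε
  obtain ⟨n, hn⟩ := ((isSigmaNormal_vector N η).comp_of_bijOn hθ).exists_forall_lt_of_separating
    hξ (ENNReal.ofReal_pos.2 (pow_pos hε 2))
  have hsmall : ∀ i, ∀ᶠ k in atTop,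
      ENNReal.ofReal (⟪(1 - p k) (ξ i), ξ i⟫_ℂ).re ≤ 2⁻¹ ^ n := fun i => by
    have h1 : Tendsto (fun k => (1 - p k) (ξ i)) atTop (𝓝 0) := by
      simpa using (tendsto_const_nhds (x := ξ i)).sub (hp1 (ξ i))
    have h2 := ENNReal.tendsto_ofReal ((Complex.continuous_re.tendsto _).comp
      (h1.inner (tendsto_const_nhds (x := ξ i))))
    rw [inner_zero_left, Complex.zero_re, ENNReal.ofReal_zero] at h2
    exact h2.eventually_le_const (ENNReal.pow_pos (ENNReal.inv_pos.2 ENNReal.ofNat_ne_top) n)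
  filter_upwards [(Set.finite_Iic n).eventually_all.2 fun i _ => hsmall i] with k hk
  have h1M := sub_mem (one_mem M) (hpM k)
  have hlt := hn (1 - p k) h1M (sub_nonneg.2 (isProjectionOp_le_one (hproj k)))
    (sub_le_self _ (isProjectionOp_nonneg (hproj k))) hk
  have hq := θ.isProjectionOp_map (hpM k) (hproj k)
  have heq : θ.toFun (1 - p k) = star (1 - θ.toFun (p k)) * (1 - θ.toFun (p k)) := by
    rw [θ.map_sub (one_mem M) (hpM k), VNHom.map_one_of_bijOn hθ, star_sub, star_one, hq.2,
      mul_sub, sub_mul, sub_mul, hq.1]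
    simp
  rw [heq, re_inner_star_mul_self, ENNReal.ofReal_lt_ofReal_iff (pow_pos hε 2)] at hlt
  rw [dist_comm, dist_eq_norm]
  exact lt_of_pow_lt_pow_left₀ 2 hε.le hlt

end Separating

lemma FNSTrace.exists_forall_norm_apply_lt {N : VonNeumannAlgebra K} (τ : FNSTrace N)
    {q : K →L[ℂ] K} (hq : q ∈ N) (hproj : IsProjectionOp q) (hfin : τ.toFun q < ⊤) (η : K)
    {ε : ℝ} (hε : 0 < ε) :
    ∃ δ : ℝ≥0∞, 0 < δ ∧
      ∀ e ∈ N, ‖e‖ ≤ 1 → τ.toFun (star e * e) < δ → ‖e (q η)‖ < ε := by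
  have habs : ∀ a ∈ N, 0 ≤ a → (ℕ → τ.toFun (q * a * q) = 0) →
      ENNReal.ofReal (⟪a (q η), q η⟫_ℂ).re = 0 := fun a ha h0 h => by
    have h1 : a (q η) = 0 := congr($(τ.mul_eq_zero_of_compression_eq_zero hq hproj ha h0 (h 0)) η)
    simp [h1]
  obtain ⟨n, hn⟩ := IsSigmaNormal.exists_forall_lt_of_absolutelyContinuous
    (fun _ : ℕ => τ.isSigmaNormal_compression hq hproj hfin) (isSigmaNormal_vector N (q η)) habs
    (ENNReal.ofReal_pos.2 (pow_pos hε 2))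
  refine ⟨2⁻¹ ^ n, ENNReal.pow_pos (ENNReal.inv_pos.2 ENNReal.ofNat_ne_top) n,
    fun e he he1 hlt => ?_⟩
  have := hn (star e * e) (mul_mem (star_mem he) he) (star_mul_self_nonneg e)
    (star_mul_self_le_one he1)
    fun _ _ => (τ.compression_star_mul_self_le hq hproj he).trans hlt.le
  rw [re_inner_star_mul_self, ENNReal.ofReal_lt_ofReal_iff (pow_pos hε 2)] at this
  exact lt_of_pow_lt_pow_left₀ 2 hε.le this

section TracePreserving

variable {M : VonNeumannAlgebra H} {N : VonNeumannAlgebra K} {τ : FNSTrace N}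
  {θ : VNHom M N}

lemma VNHom.exists_separating_sequence
    (hθ : Set.BijOn θ.toFun (M : Set (H →L[ℂ] H)) (N : Set (K →L[ℂ] K)))
    {p : ℕ → H →L[ℂ] H} (hpM : ∀ k, p k ∈ M)
    (hproj : ∀ k, IsProjectionOp (p k))
    (hp1 : ∀ ζ : H, Tendsto (fun k => p k ζ) atTop (𝓝 ζ))
    (hpfin : ∀ k, τ.toFun (θ.toFun (p k)) < ⊤) :
    ∃ ξ : ℕ → H, ∀ a ∈ M, (∀ i, a (ξ i) = 0) → a = 0 := by
  refine SSAW.exists_separating_sequence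
    (φ := fun k a => τ.toFun (θ.toFun (p k) * θ.toFun a * θ.toFun (p k)))
    (fun k => (τ.isSigmaNormal_compression (θ.mem' _ (hpM k))
      (θ.isProjectionOp_map (hpM k) (hproj k)) (hpfin k)).comp_of_bijOn hθ) fun a ha h0 h => ?_
  have hap : ∀ k, a * p k = 0 := fun k => by
    refine VNHom.eq_zero_of_bijOn hθ (mul_mem ha (hpM k)) ?_
    rw [θ.map_mul' _ ha _ (hpM k)]
    exact τ.mul_eq_zero_of_compression_eq_zero (θ.mem' _ (hpM k))
      (θ.isProjectionOp_map (hpM k) (hproj k)) (θ.mem' _ ha) (θ.map_nonneg ha h0) (h k)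
  ext ζ
  refine tendsto_nhds_unique ((a.continuous.tendsto _).comp (hp1 ζ)) ?_
  exact tendsto_const_nhds.congr fun k => congr($((hap k).symm) ζ)

lemma VNHom.tendsto_map_mul_apply
    (hθ : Set.BijOn θ.toFun (M : Set (H →L[ℂ] H)) (N : Set (K →L[ℂ] K)))
    {ξ : ℕ → H} (hξ : ∀ a ∈ M, (∀ i, a (ξ i) = 0) → a = 0)
    {θn : ℕ → VNHom M N}
    (hτ : ∀ n, ∀ x ∈ M, x.IsPositive → τ.toFun (θ.toFun x) = τ.toFun ((θn n).toFun x))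
    {X : Set (H →L[ℂ] H)} (hX : X ⊆ {x | x ∈ M ∧ ‖x‖ ≤ 1})
    (hXdense : ∀ x ∈ M, ‖x‖ ≤ 1 → ∀ ε : ℝ, 0 < ε → ∀ s : Finset H,
      ∃ y ∈ X, ∀ ξ ∈ s, ‖(x - y) ξ‖ < ε)
    (hconv : ∀ x ∈ X, ∀ η : K,
      Tendsto (fun n => (θn n).toFun x η) atTop (𝓝 (θ.toFun x η)))
    {p : H →L[ℂ] H} (hpX : p ∈ X) (hproj : IsProjectionOp p) (hpfin : τ.toFun (θ.toFun p) < ⊤)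
    {x : H →L[ℂ] H} (hx : x ∈ M) (hx1 : ‖x‖ ≤ 1) (η : K) :
    Tendsto (fun n => (θn n).toFun (x * p) η) atTop (𝓝 (θ.toFun (x * p) η)) := by
  have hpM : p ∈ M := (hX hpX).1
  set q := θ.toFun p with hq
  have hqN : q ∈ N := θ.mem' p hpM
  have hqproj : IsProjectionOp q := θ.isProjectionOp_map hpM hproj
  rw [Metric.tendsto_nhds]
  intro ε hε
  obtain ⟨δ, hδ, hsmall⟩ := τ.exists_forall_norm_apply_lt hqN hqproj hpfin η
    (show 0 < ε / 8 by positivity)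
  obtain ⟨y, hyX, d, hdM, hd1, rfl, hdlt⟩ :=
    ((τ.isSigmaNormal_compression hqN hqproj hpfin).comp_of_bijOn
      hθ).exists_mem_lt_of_separating hξ hX hXdense hδ hx hx1
  obtain ⟨hyM, hy1⟩ := hX hyX
  have hdp : d * p ∈ M := mul_mem hdM hpM
  have hdp1 : ‖d * p‖ ≤ 1 := (norm_mul_le _ _).trans
    (mul_le_one₀ hd1 (norm_nonneg p) (hX hpX).2)
  have htr : τ.toFun (θ.toFun (star (d * p) * (d * p))) < δ := by
    convert hdlt using 2
    rw [← θ.map_mul' _ hpM _ (mul_mem (star_mem hdM) hdM),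
      ← θ.map_mul' _ (mul_mem hpM (mul_mem (star_mem hdM) hdM)) _ hpM, star_mul, hproj.2]
    simp only [mul_assoc]
  have he : ‖θ.toFun (d * p) (q η)‖ < ε / 8 := by
    refine hsmall _ (θ.mem' _ hdp) (θ.norm_map_le_one hdp hdp1) ?_
    rwa [← θ.map_star_mul_self hdp]
  have hen : ∀ n, ‖(θn n).toFun (d * p) (q η)‖ < ε / 8 := fun n => by
    refine hsmall _ ((θn n).mem' _ hdp) ((θn n).norm_map_le_one hdp hdp1) ?_
    rwa [← (θn n).map_star_mul_self hdp, ← hτ n _ (mul_mem (star_mem hdp) hdp)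
      ((ContinuousLinearMap.nonneg_iff_isPositive _).1 (star_mul_self_nonneg _))]
  have hsplit : ∀ f : VNHom M N, f.toFun (((2 : ℂ) • d + y) * p) η =
      (2 : ℂ) • f.toFun (d * p) (f.toFun p η) + f.toFun y (f.toFun p η) := fun f => by
    have h1 : f.toFun (d * p) * f.toFun p = f.toFun (d * p) := by
      rw [← f.map_mul' _ hdp _ hpM, mul_assoc, hproj.1]
    have h2 : f.toFun (d * p) (f.toFun p η) = f.toFun (d * p) η := congr($h1 η)
    rw [h2, add_mul, smul_mul_assoc, f.map_add' _ (smul_mem_vonNeumann M _ hdp) _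
      (mul_mem hyM hpM),
      f.map_smul' _ _ hdp, f.map_mul' _ hyM _ hpM]
    rfl
  filter_upwards [Metric.tendsto_nhds.1 (hconv p hpX η) (ε / 8) (by positivity),
    Metric.tendsto_nhds.1 (hconv y hyX (q η)) (ε / 8) (by positivity)] with n hn1 hn2
  rw [dist_eq_norm] at hn1 hn2 ⊢
  rw [hsplit, hsplit, ← hq]
  set v := (θn n).toFun p η - q η with hv
  have hpv : (θn n).toFun p η = q η + v := by rw [hv, add_sub_cancel]
  have hle : ∀ z ∈ M, ‖z‖ ≤ 1 → ‖(θn n).toFun z v‖ < ε / 8 := fun z hz hz1 =>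
    (((θn n).toFun z).le_of_opNorm_le ((θn n).norm_map_le_one hz hz1) v).trans_lt
      (by rwa [one_mul])
  have heq : (2 : ℂ) • (θn n).toFun (d * p) ((θn n).toFun p η) +
      (θn n).toFun y ((θn n).toFun p η) -
      ((2 : ℂ) • θ.toFun (d * p) (q η) + θ.toFun y (q η)) =
      (2 : ℂ) • ((θn n).toFun (d * p) (q η) + (θn n).toFun (d * p) v - θ.toFun (d * p) (q η)) +
      ((θn n).toFun y v + ((θn n).toFun y (q η) - θ.toFun y (q η))) := by
    rw [hpv, map_add, map_add]
    module
  rw [heq]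
  calc _ ≤ 2 * (‖(θn n).toFun (d * p) (q η)‖ + ‖(θn n).toFun (d * p) v‖ +
        ‖θ.toFun (d * p) (q η)‖) +
        (‖(θn n).toFun y v‖ + ‖(θn n).toFun y (q η) - θ.toFun y (q η)‖) := by
        refine norm_add_le_of_le ?_ (norm_add_le _ _)
        rw [norm_smul, Complex.norm_ofNat]
        gcongr
        exact norm_sub_le_of_le (norm_add_le _ _) le_rfl
    _ < ε := by linarith [he, hen n, hle _ hdp hdp1, hle _ hyM hy1]

end TracePreserving

/-- Let `M`, `N` be von Neumann algebras and `τ_N` a faithful normal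
semi-finite trace on `N`. Consider a sequence of *-homomorphisms `θ_n : M → N` and a
*-isomorphism `θ : M → N` with `τ_N ∘ θ = τ_N ∘ θ_n` for all `n`. Let `X` be a subset
of the unit ball of `M`, dense in the strong operator topology, containing a sequence of
projections `(p_k)` converging strongly to `1_M` with `τ_N(θ(p_k)) < ∞`. If
`θ_n(x) → θ(x)` strongly for every `x ∈ X`, then `θ_n → θ` in the point-strong
topology. -/
theorem stmt_6
    {H : Type} [NormedAddCommGroup H] [InnerProductSpace ℂ H] [CompleteSpace H]
    {K : Type} [NormedAddCommGroup K] [InnerProductSpace ℂ K] [CompleteSpace K]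
    (M : VonNeumannAlgebra H) (N : VonNeumannAlgebra K) (τN : FNSTrace N)
    (θn : ℕ → VNHom M N) (θ : VNHom M N)
    (hbij : Set.BijOn θ.toFun (M : Set (H →L[ℂ] H)) (N : Set (K →L[ℂ] K)))
    (hτ : ∀ n, ∀ x ∈ M, x.IsPositive →
      τN.toFun (θ.toFun x) = τN.toFun ((θn n).toFun x))
    (X : Set (H →L[ℂ] H)) (hX : X ⊆ {x | x ∈ M ∧ ‖x‖ ≤ 1})
    -- X is dense in the unit ball of M for the strong operator topology
    (hXdense : ∀ x ∈ M, ‖x‖ ≤ 1 → ∀ ε : ℝ, 0 < ε → ∀ s : Finset H,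
      ∃ y ∈ X, ∀ ξ ∈ s, ‖(x - y) ξ‖ < ε)
    (p : ℕ → (H →L[ℂ] H)) (hpX : ∀ k, p k ∈ X) (hproj : ∀ k, IsProjectionOp (p k))
    (hp1 : ∀ ξ : H, Tendsto (fun k => (p k) ξ) atTop (𝓝 ξ))
    (hpfin : ∀ k, τN.toFun (θ.toFun (p k)) < ⊤)
    (hconv : ∀ x ∈ X, ∀ ξ : K,
      Tendsto (fun n => ((θn n).toFun x) ξ) atTop (𝓝 ((θ.toFun x) ξ))) :
    ∀ x ∈ M, ∀ ξ : K,
      Tendsto (fun n => ((θn n).toFun x) ξ) atTop (𝓝 ((θ.toFun x) ξ)) := by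
  have hpM : ∀ k, p k ∈ M := fun k => (hX (hpX k)).1
  obtain ⟨ξ, hξ⟩ := VNHom.exists_separating_sequence hbij hpM hproj hp1 hpfin
  have hball : ∀ x ∈ M, ‖x‖ ≤ 1 → ∀ η : K,
      Tendsto (fun n => (θn n).toFun x η) atTop (𝓝 (θ.toFun x η)) := by
    intro x hx hx1 η
    rw [Metric.tendsto_nhds]
    intro ε hε
    obtain ⟨k, hk⟩ := (Metric.tendsto_nhds.1 (VNHom.tendsto_apply_of_isProjectionOp hξ hbij hpM
      hproj hp1 η) (ε / 4) (by positivity)).exists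
    filter_upwards [Metric.tendsto_nhds.1 (hconv (p k) (hpX k) η) (ε / 4) (by positivity),
      Metric.tendsto_nhds.1 (VNHom.tendsto_map_mul_apply hbij hξ hτ hX hXdense hconv (hpX k)
        (hproj k) (hpfin k) hx hx1 η) (ε / 4) (by positivity)] with n hn1 hn2
    rw [dist_eq_norm] at hk hn1 hn2 ⊢
    rw [(θn n).map_mul' _ hx _ (hpM k), θ.map_mul' _ hx _ (hpM k)] at hn2
    have heq : (θn n).toFun x η - θ.toFun x η =
        -(θn n).toFun x ((θn n).toFun (p k) η - θ.toFun (p k) η) -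
          (θn n).toFun x (θ.toFun (p k) η - η) +
          (((θn n).toFun x * (θn n).toFun (p k)) η - (θ.toFun x * θ.toFun (p k)) η) +
          θ.toFun x (θ.toFun (p k) η - η) := by
      simp only [map_sub, ContinuousLinearMap.mul_def, ContinuousLinearMap.comp_apply]
      abel
    have hle : ∀ f : VNHom M N, ∀ v : K, ‖f.toFun x v‖ ≤ ‖v‖ := fun f v => by
      simpa using (f.toFun x).le_of_opNorm_le (f.norm_map_le_one hx hx1) v
    rw [heq]
    refine (norm_add_le_of_le (norm_add_le_of_le (norm_sub_le_of_le ((norm_neg _).le.trans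
      (hle _ _)) (hle _ _)) le_rfl) (hle _ _)).trans_lt ?_
    linarith
  intro x hx η
  have hc : (0 : ℝ) < ‖x‖ + 1 := by positivity
  have hc0 : ((‖x‖ + 1 : ℝ) : ℂ) ≠ 0 := by exact_mod_cast hc.ne'
  have hy : (((‖x‖ + 1 : ℝ) : ℂ)⁻¹ • x) ∈ M := smul_mem_vonNeumann M _ hx
  have hx' : x = ((‖x‖ + 1 : ℝ) : ℂ) • (((‖x‖ + 1 : ℝ) : ℂ)⁻¹ • x) := by
    rw [smul_smul, mul_inv_cancel₀ hc0, one_smul]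
  have hy1 : ‖((‖x‖ + 1 : ℝ) : ℂ)⁻¹ • x‖ ≤ 1 := by
    rw [norm_smul, norm_inv, Complex.norm_real, Real.norm_of_nonneg hc.le, inv_mul_le_iff₀ hc]
    linarith
  have := (hball _ hy hy1 η).const_smul ((‖x‖ + 1 : ℝ) : ℂ)
  rw [hx', θ.map_smul' _ _ hy]
  refine this.congr fun n => ?_
  rw [(θn n).map_smul' _ _ hy]
  rfl

end SSAW
end
end

section
/- Let M be a von Neumann algebra with faithful normal state φ. For every (x_n) ∈ N_ω(M) the following holds: for any ε > 0 and any compact set Ψ ⊂ M_*^+ there exist δ > 0 and W ∈ ω such that if y is in the unit ball of M and ‖y‖_φ^♯ < δ, then sup_{ψ∈Ψ} ‖x_n y‖_ψ^♯ < ε and sup_{ψ∈Ψ} ‖y x_n‖_ψ^♯ < ε for all n ∈ W. -/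
/-!
Common framework: concrete von Neumann algebras on complex Hilbert spaces,
normal states and functionals, group actions, cocycle conjugacy, tensor product
realizations, Ocneanu ultrapower sequence algebras, traces, amenability, etc.
-/

open scoped InnerProductSpace ENNReal
open Filter Topology

set_option linter.unusedSectionVars false

noncomputable section

namespace SSAW

variable {H : Type} [NormedAddCommGroup H] [InnerProductSpace ℂ H] [CompleteSpace H]
variable {K : Type} [NormedAddCommGroup K] [InnerProductSpace ℂ K] [CompleteSpace K]
variable {L : Type} [NormedAddCommGroup L] [InnerProductSpace ℂ L] [CompleteSpace L]

/-- Sequential compactness of a set of functionals with respect to the predual norm on `M`. -/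
def CompactFunctionalSet {H : Type} [NormedAddCommGroup H] [InnerProductSpace ℂ H]
    [CompleteSpace H] (M : VonNeumannAlgebra H) (Ψ : Set ((H →L[ℂ] H) → ℂ)) : Prop :=
  ∀ f : ℕ → (H →L[ℂ] H) → ℂ, (∀ n, f n ∈ Ψ) →
    ∃ ψ ∈ Ψ, ∃ σ : ℕ → ℕ, StrictMono σ ∧
      Tendsto (fun k => normOn (M : Set (H →L[ℂ] H)) (fun a => f (σ k) a - ψ a))
        atTop (𝓝 0)

/-! ### Sharp norms of positive normal functionals -/

lemma re_star_mul_self_add_eq_tsum {ψ : (H →L[ℂ] H) → ℂ} {ξ : ℕ → H}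
    (hψ : ∀ a : H →L[ℂ] H, ψ a = ∑' i, ⟪ξ i, a (ξ i)⟫_ℂ) (z : H →L[ℂ] H) :
    (ψ (star z * z + z * star z)).re = ∑' i, (‖z (ξ i)‖ ^ 2 + ‖star z (ξ i)‖ ^ 2) := by
  have key : ψ (star z * z + z * star z)
      = ((∑' i, (‖z (ξ i)‖ ^ 2 + ‖star z (ξ i)‖ ^ 2) : ℝ) : ℂ) := by
    rw [hψ, Complex.ofReal_tsum]
    refine tsum_congr fun i => ?_
    have h1 : ⟪ξ i, star z (z (ξ i))⟫_ℂ = (‖z (ξ i)‖ : ℂ) ^ 2 := by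
      rw [ContinuousLinearMap.star_eq_adjoint, ContinuousLinearMap.adjoint_inner_right,
        inner_self_eq_norm_sq_to_K]
      rfl
    have h2 : ⟪ξ i, z (star z (ξ i))⟫_ℂ = (‖star z (ξ i)‖ : ℂ) ^ 2 := by
      rw [ContinuousLinearMap.star_eq_adjoint, ← ContinuousLinearMap.adjoint_inner_left,
        inner_self_eq_norm_sq_to_K]
      rfl
    simp only [add_apply, mul_apply_eq_comp, inner_add_right,
      h1, h2]
    push_cast
    rfl
  rw [key, Complex.ofReal_re]

lemma sharpNorm_eq_sqrt_tsum {ψ : (H →L[ℂ] H) → ℂ} {ξ : ℕ → H}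
    (hψ : ∀ a : H →L[ℂ] H, ψ a = ∑' i, ⟪ξ i, a (ξ i)⟫_ℂ) (z : H →L[ℂ] H) :
    sharpNorm ψ z = √(∑' i, (‖z (ξ i)‖ ^ 2 + ‖star z (ξ i)‖ ^ 2)) := by
  rw [sharpNorm, re_star_mul_self_add_eq_tsum hψ]

lemma IsPositiveNormalFunctional.sharpNorm_sq {ψ : (H →L[ℂ] H) → ℂ}
    (hψ : IsPositiveNormalFunctional ψ) (z : H →L[ℂ] H) :
    sharpNorm ψ z ^ 2 = (ψ (star z * z + z * star z)).re := by
  obtain ⟨ξ, -, hψ⟩ := hψ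
  refine Real.sq_sqrt ?_
  rw [re_star_mul_self_add_eq_tsum hψ]
  exact tsum_nonneg fun i => by positivity

lemma norm_sq_apply_add_le {z : H →L[ℂ] H} {C : ℝ} (hC : ‖z‖ ≤ C) (η : H) :
    ‖z η‖ ^ 2 + ‖star z η‖ ^ 2 ≤ 2 * C ^ 2 * ‖η‖ ^ 2 := by
  have h1 : ‖z η‖ ≤ C * ‖η‖ := z.le_of_opNorm_le hC η
  have h2 : ‖star z η‖ ≤ C * ‖η‖ := (star z).le_of_opNorm_le (by rwa [norm_star]) η
  have h3 := pow_le_pow_left₀ (norm_nonneg _) h1 2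
  have h4 := pow_le_pow_left₀ (norm_nonneg _) h2 2
  nlinarith

/-- A closed subspace invariant under the commutant and containing the vectors that implement a
faithful functional is everything. -/
lemma eq_top_of_faithful {M : VonNeumannAlgebra H} {φ : (H →L[ℂ] H) → ℂ} {ξ : ℕ → H}
    (hφ : ∀ a : H →L[ℂ] H, φ a = ∑' i, ⟪ξ i, a (ξ i)⟫_ℂ) (hf : FaithfulOn M φ)
    (V : Submodule ℂ H) (hV : IsClosed (V : Set H)) (hξ : ∀ i, ξ i ∈ V)
    (hinv : ∀ a ∈ M.commutant, ∀ η ∈ V, a η ∈ V) : V = ⊤ := by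
  have : CompleteSpace V := hV.completeSpace_coe
  have hp : V.starProjection ∈ M := by
    rw [VonNeumannAlgebra.IsStarProjection.mem_iff isStarProjection_starProjection]
    intro a ha
    rw [Submodule.range_starProjection, Module.End.mem_invtSubmodule_iff_forall_mem_of_mem]
    exact hinv a ha
  have hq : (1 - V.starProjection : H →L[ℂ] H) ∈ M := sub_mem (one_mem M) hp
  have h0 : (1 - V.starProjection : H →L[ℂ] H) = 0 := by
    refine hf _ hq ?_
    rw [hφ]
    have : ∀ i, (1 - V.starProjection : H →L[ℂ] H) (ξ i) = 0 := fun i => by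
      simp [Submodule.starProjection_eq_self_iff.2 (hξ i)]
    simp only [mul_apply_eq_comp, this, map_zero, inner_zero_right, tsum_zero]
  rw [Submodule.eq_top_iff']
  intro η
  have h1 := DFunLike.congr_fun h0 η
  rw [sub_apply, zero_apply, sub_eq_zero] at h1
  exact Submodule.starProjection_eq_self_iff.1 h1.symm

/-- On bounded subsets of `M`, convergence on the vectors implementing a faithful functional
implies strong convergence. -/
lemma tendsto_apply_of_faithful {ι : Type*} {l : Filter ι} {M : VonNeumannAlgebra H}
    {φ : (H →L[ℂ] H) → ℂ} {ξ : ℕ → H}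
    (hφ : ∀ a : H →L[ℂ] H, φ a = ∑' i, ⟪ξ i, a (ξ i)⟫_ℂ) (hf : FaithfulOn M φ)
    {z : ι → (H →L[ℂ] H)} (hz : ∀ n, z n ∈ M) {C : ℝ} (hC : ∀ n, ‖z n‖ ≤ C)
    (h : ∀ i, Tendsto (fun n => z n (ξ i)) l (𝓝 0)) (η : H) :
    Tendsto (fun n => z n η) l (𝓝 0) := by
  let V : Submodule ℂ H :=
    { carrier := {η | Tendsto (fun n => z n η) l (𝓝 0)}
      add_mem' := fun {a b} ha hb => by
        simpa only [Set.mem_ofPred_eq, map_add, add_zero] using Tendsto.add ha hb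
      zero_mem' := by simpa using tendsto_const_nhds
      smul_mem' := fun c a ha => by
        simpa only [Set.mem_ofPred_eq, map_smul, smul_zero] using Tendsto.const_smul ha c }
  have hmem : ∀ η, η ∈ V ↔ Tendsto (fun n => z n η) l (𝓝 0) := fun _ => Iff.rfl
  have hV : IsClosed (V : Set H) := by
    rw [isClosed_iff_clusterPt]
    intro a ha
    rw [← mem_closure_iff_clusterPt, Metric.mem_closure_iff] at ha
    rw [SetLike.mem_coe, hmem, Metric.tendsto_nhds]
    intro ε hε
    obtain ⟨b, hb, hab⟩ := ha (ε / (2 * (|C| + 1))) (by positivity)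
    filter_upwards [Metric.tendsto_nhds.1 ((hmem b).1 hb) (ε / 2) (by positivity)] with n hn
    rw [dist_zero_right] at hn ⊢
    have h1 : ‖z n (a - b)‖ ≤ (|C| + 1) * ‖a - b‖ :=
      (z n).le_of_opNorm_le ((hC n).trans ((le_abs_self C).trans (by linarith))) _
    rw [dist_eq_norm, lt_div_iff₀ (by positivity)] at hab
    have h2 : z n a = z n (a - b) + z n b := by simp
    rw [h2]
    have := norm_add_le (z n (a - b)) (z n b)
    nlinarith
  have htop := eq_top_of_faithful hφ hf V hV h fun a ha η hη => by
    rw [hmem] at hη ⊢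
    have hc : ∀ n, z n (a η) = a (z n η) := fun n =>
      DFunLike.congr_fun (VonNeumannAlgebra.mem_commutant_iff.1 ha (z n) (hz n)) η
    simp only [hc]
    simpa only [map_zero, Function.comp_def] using (a.continuous.tendsto 0).comp hη
  exact (hmem η).1 (htop ▸ Submodule.mem_top)

/-- On bounded subsets of `M`, the sharp norm of a faithful normal state dominates
the sharp norm of any positive normal functional. -/
lemma tendsto_sharpNorm_of_faithful {ι : Type*} {l : Filter ι} {M : VonNeumannAlgebra H}
    {φ ψ : (H →L[ℂ] H) → ℂ} (hφ : IsPositiveNormalFunctional φ) (hf : FaithfulOn M φ)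
    (hψ : IsPositiveNormalFunctional ψ)
    {z : ι → (H →L[ℂ] H)} (hz : ∀ n, z n ∈ M) {C : ℝ} (hC : ∀ n, ‖z n‖ ≤ C)
    (h : Tendsto (fun n => sharpNorm φ (z n)) l (𝓝 0)) :
    Tendsto (fun n => sharpNorm ψ (z n)) l (𝓝 0) := by
  obtain ⟨ξ, hξ, hφ⟩ := hφ
  obtain ⟨η, hη, hψ⟩ := hψ
  have hsum : ∀ n, Summable fun i => ‖z n (ξ i)‖ ^ 2 + ‖star (z n) (ξ i)‖ ^ 2 := fun n =>
    Summable.of_nonneg_of_le (fun i => by positivity) (fun i => norm_sq_apply_add_le (hC n) _)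
      (hξ.mul_left _)
  have hle : ∀ n i, ‖z n (ξ i)‖ ^ 2 + ‖star (z n) (ξ i)‖ ^ 2 ≤ sharpNorm φ (z n) ^ 2 := by
    intro n i
    rw [sharpNorm_eq_sqrt_tsum hφ, Real.sq_sqrt (tsum_nonneg fun i => by positivity)]
    exact (hsum n).le_tsum i fun j _ => by positivity
  have hnn : ∀ n, 0 ≤ sharpNorm φ (z n) := fun n => Real.sqrt_nonneg _
  have h1 : ∀ i, Tendsto (fun n => z n (ξ i)) l (𝓝 0) := fun i =>
    squeeze_zero_norm (fun n =>
      (sq_le_sq₀ (norm_nonneg _) (hnn n)).1 (by nlinarith [hle n i, sq_nonneg ‖star (z n) (ξ i)‖])) h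
  have h2 : ∀ i, Tendsto (fun n => star (z n) (ξ i)) l (𝓝 0) := fun i =>
    squeeze_zero_norm (fun n =>
      (sq_le_sq₀ (norm_nonneg _) (hnn n)).1 (by nlinarith [hle n i, sq_nonneg ‖z n (ξ i)‖])) h
  have h3 := tendsto_apply_of_faithful hφ hf hz hC h1
  have h4 := tendsto_apply_of_faithful hφ hf (fun n => star_mem (hz n))
    (fun n => (norm_star (z n)).trans_le (hC n)) h2
  have h5 : Tendsto (fun n => ∑' i, (‖z n (η i)‖ ^ 2 + ‖star (z n) (η i)‖ ^ 2)) l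
      (𝓝 (∑' _ : ℕ, (0 : ℝ))) := by
    refine tendsto_tsum_of_dominated_convergence (hη.mul_left (2 * C ^ 2)) (fun i => ?_)
      (Eventually.of_forall fun n i => ?_)
    · simpa using ((h3 (η i)).norm.pow 2).add ((h4 (η i)).norm.pow 2)
    · rw [Real.norm_of_nonneg (by positivity)]
      exact norm_sq_apply_add_le (hC n) _
  simp only [sharpNorm_eq_sqrt_tsum hψ]
  simpa using h5.sqrt

lemma IsPositiveNormalFunctional.map_smul {ψ : (H →L[ℂ] H) → ℂ}
    (hψ : IsPositiveNormalFunctional ψ) (c : ℂ) (a : H →L[ℂ] H) : ψ (c • a) = c * ψ a := by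
  obtain ⟨ξ, -, hψ⟩ := hψ
  simp only [hψ, smul_apply, inner_smul_right, tsum_mul_left]

lemma IsPositiveNormalFunctional.exists_bound {ψ : (H →L[ℂ] H) → ℂ}
    (hψ : IsPositiveNormalFunctional ψ) : ∃ B, ∀ a : H →L[ℂ] H, ‖a‖ ≤ 1 → ‖ψ a‖ ≤ B := by
  obtain ⟨ξ, hξ, hψ⟩ := hψ
  refine ⟨∑' i, ‖ξ i‖ ^ 2, fun a ha => ?_⟩
  rw [hψ]
  refine tsum_of_norm_bounded hξ.hasSum fun i => (norm_inner_le_norm _ _).trans ?_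
  have := a.le_of_opNorm_le ha (ξ i)
  nlinarith [norm_nonneg (ξ i)]

lemma norm_sub_le_normOn_mul {M : VonNeumannAlgebra H} {ψ₁ ψ₂ : (H →L[ℂ] H) → ℂ}
    (h₁ : IsPositiveNormalFunctional ψ₁) (h₂ : IsPositiveNormalFunctional ψ₂)
    {a : H →L[ℂ] H} (ha : a ∈ M) {D : ℝ} (hD : 0 < D) (haD : ‖a‖ ≤ D) :
    ‖ψ₁ a - ψ₂ a‖ ≤ normOn (M : Set (H →L[ℂ] H)) (fun x => ψ₁ x - ψ₂ x) * D := by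
  obtain ⟨B₁, hB₁⟩ := h₁.exists_bound
  obtain ⟨B₂, hB₂⟩ := h₂.exists_bound
  have hDne : (D : ℂ) ≠ 0 := by exact_mod_cast hD.ne'
  have hle : ‖ψ₁ ((D : ℂ)⁻¹ • a) - ψ₂ ((D : ℂ)⁻¹ • a)‖
      ≤ normOn (M : Set (H →L[ℂ] H)) (fun x => ψ₁ x - ψ₂ x) := by
    refine le_csSup ⟨B₁ + B₂, ?_⟩ ⟨(D : ℂ)⁻¹ • a, ⟨?_, ?_⟩, rfl⟩
    · rintro _ ⟨x, ⟨-, hx⟩, rfl⟩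
      exact (norm_sub_le _ _).trans (add_le_add (hB₁ x hx) (hB₂ x hx))
    · exact M.toStarSubalgebra.smul_mem ha _
    · rw [norm_smul, norm_inv, Complex.norm_real, Real.norm_of_nonneg hD.le,
        inv_mul_le_iff₀ hD, mul_one]
      exact haD
  rw [h₁.map_smul, h₂.map_smul, ← mul_sub, norm_mul, norm_inv, Complex.norm_real,
    Real.norm_of_nonneg hD.le, inv_mul_le_iff₀ hD] at hle
  rwa [mul_comm]

/-- Sequences in `I_ω(M)` converge to zero uniformly on compact sets of functionals. -/
lemma IomegaSeq.eventually_sharpNorm_le {ω : Ultrafilter ℕ} {M : VonNeumannAlgebra H}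
    {z : ℕ → (H →L[ℂ] H)} (hz : IomegaSeq ω M z) {Ψ : Set ((H →L[ℂ] H) → ℂ)}
    (hΨ : ∀ ψ ∈ Ψ, IsPositiveNormalFunctional ψ) (hc : CompactFunctionalSet M Ψ)
    {ε : ℝ} (hε : 0 < ε) :
    ∀ᶠ n in (ω : Filter ℕ), ∀ ψ ∈ Ψ, sharpNorm ψ (z n) ≤ ε := by
  by_contra hcon
  rw [← Ultrafilter.eventually_not] at hcon
  obtain ⟨⟨hzM, C, hC⟩, φ, ⟨hφ, -⟩, hf, hlim⟩ := hz
  have hex : ∀ k : ℕ, ∃ n, sharpNorm φ (z n) < 1 / ((k : ℝ) + 1) ∧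
      ∃ ψ ∈ Ψ, ε < sharpNorm ψ (z n) := by
    intro k
    have h1 := hlim.eventually_lt_const (show (0 : ℝ) < 1 / ((k : ℝ) + 1) by positivity)
    obtain ⟨n, hn1, hn2⟩ := (h1.and hcon).exists
    push Not at hn2
    exact ⟨n, hn1, hn2⟩
  choose m hm f hfΨ hfε using hex
  obtain ⟨ψ, hψ, σ, hσ, hlimσ⟩ := hc f hfΨ
  have hm0 : Tendsto (fun k => sharpNorm φ (z (m k))) atTop (𝓝 0) :=
    squeeze_zero (fun k => Real.sqrt_nonneg _) (fun k => (hm k).le)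
      tendsto_one_div_add_atTop_nhds_zero_nat
  have hψ0 : Tendsto (fun k => sharpNorm ψ (z (m (σ k)))) atTop (𝓝 0) :=
    (tendsto_sharpNorm_of_faithful hφ hf (hΨ ψ hψ) (fun k => hzM (m k)) (fun k => hC (m k))
      hm0).comp hσ.tendsto_atTop
  have hlim0 := (hψ0.pow 2).add (hlimσ.mul_const (2 * C ^ 2 + 1))
  rw [zero_mul, add_zero, zero_pow two_ne_zero] at hlim0
  obtain ⟨k, hk⟩ := (hlim0.eventually_lt_const (show 0 < ε ^ 2 by positivity)).exists
  set w := z (m (σ k)) with hw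
  have hwM : w ∈ M := hzM _
  have hwn : ‖star w * w + w * star w‖ ≤ 2 * C ^ 2 + 1 := by
    have h1 := norm_add_le (star w * w) (w * star w)
    have h2 := pow_le_pow_left₀ (norm_nonneg _) (hC (m (σ k))) 2
    rw [CStarRing.norm_star_mul_self, CStarRing.norm_self_mul_star] at h1
    rw [← hw] at h2
    nlinarith
  have h1 := norm_sub_le_normOn_mul (hΨ _ (hfΨ (σ k))) (hΨ ψ hψ)
    (add_mem (mul_mem (star_mem hwM) hwM) (mul_mem hwM (star_mem hwM)))
    (by positivity) hwn
  have h2 := Complex.re_le_norm (f (σ k) (star w * w + w * star w) - ψ (star w * w + w * star w))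
  rw [Complex.sub_re, ← (hΨ _ (hfΨ _)).sharpNorm_sq, ← (hΨ _ hψ).sharpNorm_sq] at h2
  have h3 := pow_lt_pow_left₀ (hfε (σ k)) hε.le two_ne_zero
  rw [← hw] at h3
  linarith

/-- Let `M` be a von Neumann algebra with faithful normal state `φ`.
For every `(x_n) ∈ N_ω(M)`: for any `ε > 0` and compact `Ψ ⊂ M_*^+` there exist
`δ > 0` and `W ∈ ω` such that if `y` is in the unit ball of `M` and `‖y‖_φ^♯ < δ`,
then `sup_{ψ∈Ψ} ‖x_n y‖_ψ^♯ < ε` and `sup_{ψ∈Ψ} ‖y x_n‖_ψ^♯ < ε` for all `n ∈ W`. -/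
theorem stmt_7
    (ω : Ultrafilter ℕ) (hω : (ω : Filter ℕ) ≤ Filter.cofinite)
    {H : Type} [NormedAddCommGroup H] [InnerProductSpace ℂ H] [CompleteSpace H]
    (M : VonNeumannAlgebra H)
    (φ : (H →L[ℂ] H) → ℂ) (hφ : IsNormalState M φ) (hφf : FaithfulOn M φ)
    (x : ℕ → (H →L[ℂ] H)) (hx : NomegaSeq ω M x) :
    ∀ ε : ℝ, 0 < ε → ∀ Ψ : Set ((H →L[ℂ] H) → ℂ),
      (∀ ψ ∈ Ψ, IsPositiveNormalFunctional ψ) → CompactFunctionalSet M Ψ →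
      ∃ δ : ℝ, 0 < δ ∧ ∃ W ∈ ω, ∀ y : H →L[ℂ] H, y ∈ M → ‖y‖ ≤ 1 →
        sharpNorm φ y < δ → ∀ n ∈ W,
          (⨆ ψ ∈ Ψ, sharpNorm ψ (x n * y)) < ε ∧
          (⨆ ψ ∈ Ψ, sharpNorm ψ (y * x n)) < ε := by
  intro ε hε Ψ hΨ hc
  obtain ⟨hφp, hφ1⟩ := hφ
  let Bad : ℕ → (H →L[ℂ] H) → Prop := fun n y =>
    (∃ ψ ∈ Ψ, ε / 2 < sharpNorm ψ (x n * y)) ∨ ∃ ψ ∈ Ψ, ε / 2 < sharpNorm ψ (y * x n)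
  let A : ℕ → ℕ → Prop := fun n k =>
    ∃ y ∈ M, ‖y‖ ≤ 1 ∧ sharpNorm φ y < 1 / ((k : ℝ) + 1) ∧ Bad n y
  have hiSup : ∀ g : ((H →L[ℂ] H) → ℂ) → ℝ, (∀ ψ ∈ Ψ, g ψ ≤ ε / 2) → (⨆ ψ ∈ Ψ, g ψ) < ε :=
    fun g hg => (Real.iSup_le (fun ψ => Real.iSup_le (hg ψ) (by positivity))
      (by positivity)).trans_lt (half_lt_self hε)
  suffices hA : ∃ k, ∀ᶠ n in (ω : Filter ℕ), ¬ A n k by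
    obtain ⟨k, hk⟩ := hA
    refine ⟨1 / ((k : ℝ) + 1), by positivity, {n | ¬ A n k}, hk, fun y hy hy1 hyφ n hn => ?_⟩
    have hgood : ¬ Bad n y := fun hb => hn ⟨y, hy, hy1, hyφ, hb⟩
    simp only [Bad] at hgood
    push Not at hgood
    exact ⟨hiSup _ hgood.1, hiSup _ hgood.2⟩
  by_contra hcon
  have hev : ∀ k, ∀ᶠ n in (ω : Filter ℕ), A n k := by
    push Not at hcon
    exact hcon
  have hchoice : ∀ n, ∃ y ∈ M, ‖y‖ ≤ 1 ∧ (A n 0 → Bad n y) ∧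
      ∀ k ≤ n, A n k → sharpNorm φ y < 1 / ((k : ℝ) + 1) := by
    classical
    intro n
    by_cases h0 : A n 0
    · obtain ⟨y, hy, hy1, hyφ, hb⟩ := Nat.findGreatest_spec (P := A n) (Nat.zero_le n) h0
      refine ⟨y, hy, hy1, fun _ => hb, fun k hkn hk => hyφ.trans_le ?_⟩
      exact one_div_le_one_div_of_le (by positivity)
        (by exact_mod_cast Nat.succ_le_succ (Nat.le_findGreatest hkn hk))
    · refine ⟨0, zero_mem M, by simp, fun h => absurd h h0, fun k _ hk => ?_⟩
      obtain ⟨y, hy, hy1, hyφ, hb⟩ := hk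
      exact absurd ⟨y, hy, hy1, hyφ.trans_le
        (one_div_le_one_div_of_le (by positivity) (by simp)), hb⟩ h0
  choose y hyM hy1 hyBad hyφ using hchoice
  have hyI : IomegaSeq ω M y := by
    refine ⟨⟨hyM, 1, hy1⟩, φ, ⟨hφp, hφ1⟩, hφf, ?_⟩
    rw [Metric.tendsto_nhds]
    intro r hr
    obtain ⟨k, hk⟩ := exists_nat_one_div_lt hr
    filter_upwards [hev k, hω (Nat.cofinite_eq_atTop ▸ eventually_ge_atTop k)] with n hn hkn
    rw [Real.dist_0_eq_abs, abs_of_nonneg (show 0 ≤ sharpNorm φ (y n) from Real.sqrt_nonneg _)]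
    exact (hyφ n k hkn hn).trans hk
  obtain ⟨hl, hr⟩ := hx.2 y hyI
  obtain ⟨n, ⟨hn0, hnl⟩, hnr⟩ := (((hev 0).and
    (hl.eventually_sharpNorm_le hΨ hc (half_pos hε))).and
    (hr.eventually_sharpNorm_le hΨ hc (half_pos hε))).exists
  rcases hyBad n hn0 with ⟨ψ, hψ, hlt⟩ | ⟨ψ, hψ, hlt⟩
  · exact absurd hlt (hnl ψ hψ).not_gt
  · exact absurd hlt (hnr ψ hψ).not_gt

end SSAW
end
end
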